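/- arXiv:1306.0864 — 4 statements merged into one kernel-verified Lean document; each statement's English description precedes it below -/
import Mathlib

section
/- For every natural number N there exists a finite simple graph G with more than N vertices such that the degree sequence of G is different from the degree sequence of its complement G̅ (as multisets), yet for every natural number k the number of proper k-colorings of G equals the number of proper k-colorings of G̅. -/
open SimpleGraph

/-- The number of proper `k`-colorings of `G` (the chromatic polynomial evaluated at `k`). -/
noncomputable def numColorings {V : Type*} [Fintype V] (G : SimpleGraph V) (k : ℕ) : ℕ :=
  Nat.card (G.Coloring (Fin k))
/-- The degree sequence of `G`, as a multiset of vertex degrees. -/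
noncomputable def degreeMultiset {V : Type*} [Fintype V] (G : SimpleGraph V) : Multiset ℕ :=
  Finset.univ.val.map fun v => Nat.card (G.neighborSet v)

namespace ChromComp

/-! ### Symbolic counting of colorings -/

/-- The block sizes-free evaluator: final numbers of colors over all proper set partitions. -/
def leaves {n : ℕ} (adj : Fin n → Fin n → Bool) : List (Fin n) → ℕ → (Fin n → ℕ) → List ℕ
  | [], j, _ => [j]
  | v :: l, j, r =>
    (List.range j).flatMap (fun b =>
      if (∀ u, u ∉ v :: l → adj u v = true → r u ≠ b) then
        leaves adj l j (Function.update r v b) else [])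
    ++ leaves adj l (j + 1) (Function.update r v j)

/-- Number of ways to extend a partial coloring that uses `j` of `k` colors. -/
def ext {n : ℕ} (adj : Fin n → Fin n → Bool) (k : ℕ) : List (Fin n) → ℕ → (Fin n → ℕ) → ℕ
  | [], _, _ => 1
  | v :: l, j, r =>
    ((List.range j).map (fun b =>
      if (∀ u, u ∉ v :: l → adj u v = true → r u ≠ b) then
        ext adj k l j (Function.update r v b) else 0)).sum
    + (k - j) * ext adj k l (j + 1) (Function.update r v j)

lemma sum_map_flatMap {α : Type*} (L : List α) (g : α → List ℕ) (f : ℕ → ℕ) :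
    ((L.flatMap g).map f).sum = (L.map (fun a => ((g a).map f).sum)).sum := by
  induction L with
  | nil => simp
  | cons a L ih => simp [List.flatMap_cons, ih]

lemma ext_mul {n : ℕ} (adj : Fin n → Fin n → Bool) (k : ℕ) (l : List (Fin n)) :
    ∀ (j : ℕ) (r : Fin n → ℕ),
      ext adj k l j r * k.descFactorial j = ((leaves adj l j r).map k.descFactorial).sum := by
  induction l with
  | nil => intro j r; simp [ext, leaves]
  | cons v l ih =>
    intro j r
    rw [ext, leaves, List.map_append, List.sum_append, sum_map_flatMap, add_mul, ← ih (j + 1),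
      Nat.descFactorial_succ, ← List.sum_map_mul_right]
    congr 1
    · congr 1
      apply List.map_congr_left
      intro b _
      split_ifs
      · exact ih _ _
      · simp
    · ring

/-- Proper colorings which agree with `col ∘ r` outside of `l`. -/
def pc {n : ℕ} (G : SimpleGraph (Fin n)) {k : ℕ} (l : List (Fin n)) (f : Fin n → Fin k) :
    Set (Fin n → Fin k) :=
  {c | (∀ u w, G.Adj u w → c u ≠ c w) ∧ ∀ u, u ∉ l → c u = f u}

lemma pc_cons {n : ℕ} (G : SimpleGraph (Fin n)) {k : ℕ} (v : Fin n) (l : List (Fin n))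
    (hv : v ∉ l) (f : Fin n → Fin k) :
    (pc G (v :: l) f).ncard = ∑ a : Fin k, (pc G l (Function.update f v a)).ncard := by
  classical
  have h : pc G (v :: l) f = ⋃ a : Fin k, pc G l (Function.update f v a) := by
    ext c
    simp only [pc, Set.mem_ofPred_eq, Set.mem_iUnion, List.mem_cons, not_or]
    constructor
    · rintro ⟨h1, h2⟩
      refine ⟨c v, h1, fun u hu => ?_⟩
      by_cases huv : u = v
      · subst huv; simp
      · rw [Function.update_of_ne huv]; exact h2 u ⟨huv, hu⟩
    · rintro ⟨a, h1, h2⟩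
      refine ⟨h1, fun u hu => ?_⟩
      have := h2 u hu.2
      rwa [Function.update_of_ne hu.1] at this
  have hd : ∀ a : Fin k, ∀ c ∈ pc G l (Function.update f v a), c v = a := by
    intro a c hc
    have := hc.2 v hv
    rwa [Function.update_self] at this
  have hfin : ∀ a : Fin k, (pc G l (Function.update f v a)).Finite := fun a => Set.toFinite _
  have hu : (⋃ a : Fin k, pc G l (Function.update f v a)) =
      ((Finset.univ.biUnion fun a : Fin k => (hfin a).toFinset : Finset (Fin n → Fin k)) :
        Set (Fin n → Fin k)) := by
    ext c; simp
  rw [h, hu, Set.ncard_coe_finset, Finset.card_biUnion]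
  · exact Finset.sum_congr rfl fun a _ => (Set.ncard_eq_toFinset_card _ (hfin a)).symm
  · intro a _ b _ hab
    change Disjoint _ _
    rw [Finset.disjoint_left]
    intro c hc hc'
    rw [Set.Finite.mem_toFinset] at hc hc'
    exact hab ((hd a c hc).symm.trans (hd b c hc'))

lemma pc_eq_ext {n : ℕ} (G : SimpleGraph (Fin n)) (adj : Fin n → Fin n → Bool)
    (hadj : ∀ u w, G.Adj u w ↔ adj u w = true) (k : ℕ) (l : List (Fin n)) :
    ∀ (j : ℕ) (r : Fin n → ℕ) (col : ℕ → Fin k), l.Nodup →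
      (∀ a < j, ∀ b < j, col a = col b → a = b) → (∀ u, u ∉ l → r u < j) →
      (∀ u w, u ∉ l → w ∉ l → G.Adj u w → r u ≠ r w) →
      (pc G l (fun u => col (r u))).ncard = ext adj k l j r := by
  classical
  induction l with
  | nil =>
    intro j r col _ hcol hr hp
    have : pc G [] (fun u => col (r u)) = {fun u => col (r u)} := by
      ext c
      simp only [pc, Set.mem_ofPred_eq, Set.mem_singleton_iff]
      constructor
      · rintro ⟨_, h⟩; funext u; exact h u (by simp)
      · rintro rfl
        refine ⟨fun u w huw h => ?_, fun u _ => rfl⟩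
        exact hp u w (by simp) (by simp) huw (hcol _ (hr u (by simp)) _ (hr w (by simp)) h)
    rw [this, Set.ncard_singleton, ext]
  | cons v l ih =>
    intro j r col hnd hcol hr hp
    rw [List.nodup_cons] at hnd
    obtain ⟨hv, hl⟩ := hnd
    have hr' : ∀ u, u ≠ v → u ∉ l → r u < j := fun u h1 h2 => hr u (by simp [h1, h2])
    have hp' : ∀ u w, u ≠ v → w ≠ v → u ∉ l → w ∉ l → G.Adj u w → r u ≠ r w :=
      fun u w h1 h2 h3 h4 => hp u w (by simp [h1, h3]) (by simp [h2, h4])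
    rw [pc_cons G v l hv]
    set I : Finset (Fin k) := (Finset.range j).image col with hI
    have hinj : Set.InjOn col (Finset.range j) := by
      intro a ha b hb h
      exact hcol a (by simpa using ha) b (by simpa using hb) h
    have hIc : I.card = j := by
      rw [hI, Finset.card_image_of_injOn hinj, Finset.card_range]
    rw [← Finset.sum_add_sum_compl I, ext]
    congr 1
    · rw [hI, Finset.sum_image hinj, ← List.sum_toFinset _ List.nodup_range, List.toFinset_range]
      apply Finset.sum_congr rfl
      intro b hb
      rw [Finset.mem_range] at hb
      have hupd : Function.update (fun u => col (r u)) v (col b) =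
          fun u => col (Function.update r v b u) := by
        funext u
        by_cases h : u = v
        · subst h; simp
        · simp [h]
      rw [hupd]
      split_ifs with hc
      · have hc' : ∀ u, u ≠ v → u ∉ l → G.Adj u v → r u ≠ b := fun u h1 h2 h3 =>
          hc u (by simp [h1, h2]) ((hadj _ _).1 h3)
        apply ih _ _ _ hl hcol
        · intro u hu
          by_cases h : u = v
          · subst h; simpa using hb
          · rw [Function.update_of_ne h]; exact hr' u h hu
        · intro u w hu hw huw
          by_cases h : u = v
          · subst h
            have h2 : w ≠ u := huw.ne'
            rw [Function.update_self, Function.update_of_ne h2]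
            exact (hc' w h2 hw huw.symm).symm
          · by_cases h2 : w = v
            · subst h2
              rw [Function.update_self, Function.update_of_ne h]
              exact hc' u h hu huw
            · rw [Function.update_of_ne h, Function.update_of_ne h2]
              exact hp' u w h h2 hu hw huw
      · push Not at hc
        obtain ⟨u, hu, huv, hb⟩ := hc
        simp only [List.mem_cons, not_or] at hu
        have : pc G l (fun u => col (Function.update r v b u)) = ∅ := by
          ext c
          simp only [pc, Set.mem_ofPred_eq, Set.mem_empty_iff_false, iff_false]
          rintro ⟨h1, h2⟩
          apply h1 u v ((hadj _ _).2 huv)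
          rw [h2 u hu.2, h2 v hv, Function.update_self, Function.update_of_ne hu.1, hb]
        rw [this, Set.ncard_empty]
    · have hcc : (Iᶜ).card = k - j := by rw [Finset.card_compl, hIc, Fintype.card_fin]
      rw [← hcc, ← smul_eq_mul, ← Finset.sum_const]
      apply Finset.sum_congr rfl
      intro a ha
      have ha' : ∀ b < j, col b ≠ a := by
        intro b hb h
        rw [Finset.mem_compl] at ha
        exact ha (Finset.mem_image.2 ⟨b, by simpa using hb, h⟩)
      have hpc : pc G l (Function.update (fun u => col (r u)) v a) =
          pc G l (fun u => (Function.update col j a) (Function.update r v j u)) := by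
        ext c
        simp only [pc, Set.mem_ofPred_eq]
        refine and_congr_right fun _ => forall_congr' fun u => imp_congr_right fun hu => ?_
        by_cases h : u = v
        · subst h; simp
        · rw [Function.update_of_ne h, Function.update_of_ne h,
            Function.update_of_ne (hr' u h hu).ne]
      rw [hpc]
      apply ih _ _ _ hl
      · intro x hx y hy hxy
        by_cases h : x = j
        · by_cases h2 : y = j
          · rw [h, h2]
          · rw [h, Function.update_self, Function.update_of_ne h2] at hxy
            exact absurd hxy.symm (ha' y (by omega))
        · by_cases h2 : y = j
          · rw [h2, Function.update_self, Function.update_of_ne h] at hxy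
            exact absurd hxy (ha' x (by omega))
          · rw [Function.update_of_ne h, Function.update_of_ne h2] at hxy
            exact hcol x (by omega) y (by omega) hxy
      · intro u hu
        by_cases h : u = v
        · subst h; simp
        · rw [Function.update_of_ne h]; exact Nat.lt_succ_of_lt (hr' u h hu)
      · intro u w hu hw huw
        by_cases h : u = v
        · subst h
          have h2 : w ≠ u := huw.ne'
          rw [Function.update_self, Function.update_of_ne h2]
          exact (hr' w h2 hw).ne'
        · by_cases h2 : w = v
          · subst h2
            rw [Function.update_self, Function.update_of_ne h]
            exact (hr' u h hu).ne
          · rw [Function.update_of_ne h, Function.update_of_ne h2]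
            exact hp' u w h h2 hu hw huw

/-- Colorings as a set of functions. -/
lemma numColorings_eq {n : ℕ} (G : SimpleGraph (Fin (n + 1))) (adj : Fin (n + 1) → Fin (n + 1) → Bool)
    (hadj : ∀ u w, G.Adj u w ↔ adj u w = true) (k : ℕ) :
    numColorings G k =
      ((leaves adj (List.finRange (n + 1)) 0 (fun _ => 0)).map k.descFactorial).sum := by
  rw [← ext_mul, Nat.descFactorial_zero, mul_one]
  rcases Nat.eq_zero_or_pos k with rfl | hk
  · have : IsEmpty (G.Coloring (Fin 0)) := ⟨fun c => (c 0).elim0⟩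
    rw [numColorings, Nat.card_of_isEmpty, List.finRange_succ, ext]
    simp
  · have := pc_eq_ext G adj hadj k (List.finRange (n + 1)) 0 (fun _ => 0) (fun _ => ⟨0, hk⟩)
      (List.nodup_finRange _) (by simp) (by simp) (by simp)
    rw [← this, numColorings, ← Nat.card_coe_set_eq]
    apply Nat.card_congr
    refine ⟨fun c => ⟨c, fun u w h => c.valid h, by simp⟩,
      fun c => Coloring.mk c.1 (fun {u w} h => c.2.1 u w h), fun c => ?_, fun c => ?_⟩
    · ext; rfl
    · rfl

/-! ### The base graph -/

/-- Adjacency of the base graph, as a bit table. -/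
def adjB (i j : Fin 9) : Bool := Nat.testBit 473111367182224814587908 (9 * i.val + j.val)

/-- Adjacency of the complement of the base graph. -/
def adjC (i j : Fin 9) : Bool := !(i == j) && !(adjB i j)

/-- The base graph on nine vertices. -/
def B : SimpleGraph (Fin 9) where
  Adj i j := adjB i j = true
  symm := ⟨by decide +kernel⟩
  loopless := ⟨by decide +kernel⟩

lemma base_perm : (leaves adjB (List.finRange 9) 0 (fun _ => 0)).Perm
    (leaves adjC (List.finRange 9) 0 (fun _ => 0)) := by
  decide +kernel

lemma base_col (k : ℕ) : numColorings B k = numColorings Bᶜ k := by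
  rw [numColorings_eq B adjB (fun _ _ => Iff.rfl), numColorings_eq Bᶜ adjC]
  · exact (base_perm.map _).sum_eq
  · intro u w
    simp [SimpleGraph.compl_adj, adjC, B]

lemma base_deg : degreeMultiset B ≠ degreeMultiset Bᶜ := by
  intro h
  have h1 : ∀ (G : SimpleGraph (Fin 9)) (adj : Fin 9 → Fin 9 → Bool),
      (∀ u w, G.Adj u w ↔ adj u w = true) →
      degreeMultiset G = Finset.univ.val.map fun v =>
        (Finset.univ.filter fun w => adj v w = true).card := by
    intro G adj hadj
    unfold degreeMultiset
    congr 1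
    funext v
    rw [Nat.card_coe_set_eq, ← Set.ncard_coe_finset]
    congr 1
    ext w
    simp [hadj]
  rw [h1 B adjB (fun _ _ => Iff.rfl), h1 Bᶜ adjC] at h
  · revert h; decide +kernel
  · intro u w
    simp [SimpleGraph.compl_adj, adjC, B]

/-! ### Extension by a path on four vertices -/

/-- Adjacency of the path 0-1-2-3. -/
def p4 (i j : Fin 4) : Bool := i.val + 1 == j.val || j.val + 1 == i.val

/-- Inner vertices. -/
def mid (i : Fin 4) : Bool := i == 1 || i == 2

/-- Adjacency of the extended graph. -/
def xadj {V : Type*} (G : SimpleGraph V) : V ⊕ Fin 4 → V ⊕ Fin 4 → Prop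
  | .inl u, .inl w => G.Adj u w
  | .inl _, .inr i => mid i = true
  | .inr i, .inl _ => mid i = true
  | .inr i, .inr j => p4 i j = true

/-- The graph `G` together with a path on four vertices whose inner vertices are joined
to all of `G`. -/
def X {V : Type*} (G : SimpleGraph V) : SimpleGraph (V ⊕ Fin 4) where
  Adj := xadj G
  symm := ⟨by
    rintro (u | i) (w | j) h
    · exact SimpleGraph.Adj.symm (G := G) h
    · exact h
    · exact h
    · revert h; simp only [xadj]; revert i j; decide⟩
  loopless := ⟨by
    rintro (u | i) h
    · exact G.loopless.irrefl _ h
    · revert h; simp only [xadj]; revert i; decide⟩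

/-- The self-complementing permutation of the path. -/
def sw : Fin 4 ≃ Fin 4 where
  toFun := ![1, 3, 0, 2]
  invFun := ![2, 0, 3, 1]
  left_inv := by decide
  right_inv := by decide

/-- The complement of an extension is the extension of the complement. -/
def isoCompl {V : Type*} (G : SimpleGraph V) : (X G)ᶜ ≃g X (Gᶜ) where
  toEquiv := Equiv.sumCongr (Equiv.refl V) sw
  map_rel_iff' := by
    rintro (u | i) (w | j)
    · simp [X, xadj, SimpleGraph.compl_adj]
    · simp only [X, xadj, SimpleGraph.compl_adj, Equiv.sumCongr_apply, Sum.map_inl, Sum.map_inr]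
      simp only [ne_eq, reduceCtorEq, not_false_eq_true, true_and]
      revert j; decide
    · simp only [X, xadj, SimpleGraph.compl_adj, Equiv.sumCongr_apply, Sum.map_inl, Sum.map_inr]
      simp only [ne_eq, reduceCtorEq, not_false_eq_true, true_and]
      revert i; decide
    · simp only [X, xadj, SimpleGraph.compl_adj, Equiv.sumCongr_apply, Sum.map_inr]
      simp only [ne_eq, Sum.inr.injEq]
      revert i j; decide

lemma numColorings_iso {V W : Type*} [Fintype V] [Fintype W] {G : SimpleGraph V}
    {H : SimpleGraph W} (e : G ≃g H) (k : ℕ) : numColorings G k = numColorings H k := by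
  apply Nat.card_congr
  refine ⟨fun c => c.comp e.symm.toHom, fun c => c.comp e.toHom, fun c => ?_, fun c => ?_⟩
  · apply RelHom.ext; intro v; simp
  · apply RelHom.ext; intro v; simp

lemma degreeMultiset_iso {V W : Type*} [Fintype V] [Fintype W] {G : SimpleGraph V}
    {H : SimpleGraph W} (e : G ≃g H) : degreeMultiset G = degreeMultiset H := by
  unfold degreeMultiset
  have h : (Finset.univ : Finset W) = Finset.univ.map e.toEquiv.toEmbedding := by simp
  rw [h, Finset.map_val, Multiset.map_map]
  apply Multiset.map_congr rfl
  intro v _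
  exact Nat.card_congr (e.mapNeighborSet v)

lemma degreeMultiset_X {V : Type*} [Fintype V] (G : SimpleGraph V) :
    degreeMultiset (X G) = (degreeMultiset G).map (· + 2) +
      (Finset.univ : Finset (Fin 4)).val.map
        (fun i => (if mid i then Fintype.card V else 0) + Nat.card {j // p4 i j = true}) := by
  classical
  unfold degreeMultiset
  have hu : (Finset.univ : Finset (V ⊕ Fin 4)).val =
      (Finset.univ : Finset V).val.map Sum.inl + (Finset.univ : Finset (Fin 4)).val.map Sum.inr := rfl
  rw [hu, Multiset.map_add, Multiset.map_map, Multiset.map_map, Multiset.map_map]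
  congr 1
  · apply Multiset.map_congr rfl
    intro v _
    simp only [Function.comp]
    have : Nat.card {i : Fin 4 // mid i = true} = 2 := by
      rw [Nat.card_eq_fintype_card]; decide
    rw [← this, ← Nat.card_sum]
    exact Nat.card_congr (Equiv.subtypeSum (p := fun x => (X G).Adj (Sum.inl v) x))
  · apply Multiset.map_congr rfl
    intro i _
    simp only [Function.comp]
    have : (if mid i then Fintype.card V else 0) = Nat.card {_v : V // mid i = true} := by
      split_ifs with h
      · simp [h]
      · simp [h]
    rw [this, ← Nat.card_sum]
    exact Nat.card_congr (Equiv.subtypeSum (p := fun x => (X G).Adj (Sum.inr i) x))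

/-- Colorings of an extension. -/
def colX {V : Type*} (G : SimpleGraph V) (C : Type*) :
    (X G).Coloring C ≃ Σ f : {f : Fin 4 → C // ∀ i j, p4 i j = true → f i ≠ f j},
      G.Coloring {c : C // ∀ i, mid i = true → c ≠ f.1 i} where
  toFun c := ⟨⟨fun i => c (.inr i), fun i j h => c.valid (v := .inr i) (w := .inr j) h⟩,
    Coloring.mk (fun v => ⟨c (.inl v), fun i h => c.valid (v := .inl v) (w := .inr i) h⟩)
      (fun {u w} h he => c.valid (v := .inl u) (w := .inl w) h (congrArg Subtype.val he))⟩
  invFun p := Coloring.mk (Sum.elim (fun v => (p.2 v).1) p.1.1) (by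
    rintro (u | i) (w | j) h
    · intro he; exact p.2.valid (v := u) (w := w) h (Subtype.ext he)
    · exact (p.2 u).2 j h
    · exact ((p.2 w).2 i h).symm
    · exact p.1.2 i j h)
  left_inv c := by
    apply RelHom.ext
    rintro (u | i) <;> rfl
  right_inv p := rfl

lemma coloring_card_fin {U : Type*} (K : SimpleGraph U) (C : Type*) [Finite C] :
    Nat.card (K.Coloring C) = Nat.card (K.Coloring (Fin (Nat.card C))) := by
  have e := Finite.equivFin C
  apply Nat.card_congr
  exact ⟨fun c => Coloring.mk (fun v => e (c v)) (fun {u w} h he => c.valid h (e.injective he)),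
    fun c => Coloring.mk (fun v => e.symm (c v))
      (fun {u w} h he => c.valid h (e.symm.injective he)),
    fun c => by apply RelHom.ext; intro v; exact e.symm_apply_apply _,
    fun c => by apply RelHom.ext; intro v; exact e.apply_symm_apply _⟩

lemma coloring_equiv {V W : Type*} [Fintype V] [Fintype W] {G : SimpleGraph V}
    {H : SimpleGraph W} (h : ∀ k, numColorings G k = numColorings H k) (C : Type*) [Finite C] :
    Nat.card (G.Coloring C) = Nat.card (H.Coloring C) := by
  rw [coloring_card_fin G C, coloring_card_fin H C]
  exact h _

lemma coloring_finite {U : Type*} [Finite U] (K : SimpleGraph U) (D : Type*) [Finite D] :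
    Finite (K.Coloring D) :=
  Finite.of_injective (fun c => (c : U → D)) DFunLike.coe_injective

lemma numColorings_X {V W : Type*} [Fintype V] [Fintype W] {G : SimpleGraph V}
    {H : SimpleGraph W} (h : ∀ k, numColorings G k = numColorings H k) (k : ℕ) :
    numColorings (X G) k = numColorings (X H) k := by
  classical
  unfold numColorings
  rw [Nat.card_congr (colX G (Fin k)), Nat.card_congr (colX H (Fin k))]
  have fG := fun (D : Type) [Finite D] => coloring_finite G D
  have fH := fun (D : Type) [Finite D] => coloring_finite H D
  rw [Nat.card_sigma, Nat.card_sigma]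
  exact Finset.sum_congr rfl fun f _ => coloring_equiv h _

/-- The property of a graph to be constructed. -/
def Good {V : Type*} [Fintype V] (G : SimpleGraph V) : Prop :=
  degreeMultiset G ≠ degreeMultiset Gᶜ ∧ ∀ k : ℕ, numColorings G k = numColorings Gᶜ k

lemma good_X {V : Type*} [Fintype V] {G : SimpleGraph V} (h : Good G) : Good (X G) := by
  refine ⟨?_, fun k => ?_⟩
  · rw [degreeMultiset_iso (isoCompl G), degreeMultiset_X, degreeMultiset_X]
    intro he
    exact h.1 (Multiset.map_injective (add_left_injective 2) (add_right_cancel he))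
  · rw [numColorings_iso (isoCompl G)]
    exact numColorings_X h.2 k

lemma good_iso {V W : Type*} [Fintype V] [Fintype W] {G : SimpleGraph V}
    {H : SimpleGraph W} (e : G ≃g H) (h : Good G) : Good H := by
  have e' : Gᶜ ≃g Hᶜ :=
    { toEquiv := e.toEquiv
      map_rel_iff' := by 
        intro a b
        have h1 : H.Adj (e a) (e b) ↔ G.Adj a b := e.map_rel_iff
        simp [SimpleGraph.compl_adj, h1] }
  refine ⟨?_, fun k => ?_⟩
  · rw [← degreeMultiset_iso e, ← degreeMultiset_iso e']; exact h.1
  · rw [← numColorings_iso e, ← numColorings_iso e']; exact h.2 k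

lemma exists_good (m : ℕ) : ∃ G : SimpleGraph (Fin (9 + 4 * m)), Good G := by
  induction m with
  | zero => exact ⟨B, base_deg, base_col⟩
  | succ m ih =>
    obtain ⟨G, hG⟩ := ih
    let e : Fin (9 + 4 * m) ⊕ Fin 4 ≃ Fin (9 + 4 * (m + 1)) := finSumFinEquiv
    exact ⟨(X G).map e.toEmbedding, good_iso (SimpleGraph.Iso.map e (X G)) (good_X hG)⟩

end ChromComp

/-- For every `N` there is a graph on more than `N` vertices whose degree sequence differs
from that of its complement, yet which has the same number of proper `k`-colorings as its
complement for every natural number `k`. -/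
theorem stmt_1 (N : ℕ) :
    ∃ (n : ℕ) (G : SimpleGraph (Fin n)),
      n > N ∧
      degreeMultiset G ≠ degreeMultiset Gᶜ ∧
      ∀ k : ℕ, numColorings G k = numColorings Gᶜ k := by
  obtain ⟨G, hG⟩ := ChromComp.exists_good N
  exact ⟨9 + 4 * N, G, by omega, hG.1, hG.2⟩
end

section
/- There exists a finite simple graph G on 8 vertices such that G is not isomorphic to its complement G̅, yet s(G) = s(G̅). -/
open SimpleGraph

open scoped Classical

/-- The multiset of orders of the connected components of a graph. -/

noncomputable def componentOrders {V : Type*} [Fintype V] (G' : SimpleGraph V) : Multiset ℕ :=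
  ((Finset.univ.val.map fun v => G'.connectedComponentMk v).dedup).map fun c => Nat.card c.supp

/-- The subgraph sequence `s(G)`: the multiset, over all edge subsets `F ⊆ E(G)`, of the
subgraph descriptions `(|F|, multiset of orders of connected components of (V, F))`. -/

noncomputable def subgraphSeq {V : Type*} [Fintype V] (G : SimpleGraph V) :
    Multiset (ℕ × Multiset ℕ) :=
  G.edgeFinset.powerset.val.map fun (F : Finset (Sym2 V)) =>
    (F.card, componentOrders (SimpleGraph.fromEdgeSet (F : Set (Sym2 V))))

def E1 : List (ℕ × ℕ) := [(0,1),(1,2),(0,3),(1,3),(2,3),(0,4),(1,4),(0,5),(2,5),(3,5),(2,6),(4,6),(0,7),(1,7)]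

def E2 : List (ℕ × ℕ) := [(0,2),(0,6),(1,5),(1,6),(2,4),(2,7),(3,4),(3,6),(3,7),(4,5),(4,7),(5,6),(5,7),(6,7)]

def getK {α : Type} : List ℕ → ℕ → (ℕ → α) → α
  | [], _, c => c 0
  | x :: _, 0, c => c x
  | _ :: t, n+1, c => getK t n c

def joinK {α : Type} (la lb : ℕ) : List ℕ → (List ℕ → α) → α
  | [], c => c []
  | x :: t, c => bif Nat.beq x lb then joinK la lb t (fun r => c (la :: r))
      else joinK la lb t (fun r => c (x :: r))

def cnt (y : ℕ) : List ℕ → ℕ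
  | [] => 0
  | x :: t => bif Nat.beq x y then cnt y t + 1 else cnt y t

/-- Weight of a vertex lying in a block of size `s`. -/
def wt (s : ℕ) : ℕ := (4604716288 / 16 ^ s) % 16

def hsum (l : List ℕ) : List ℕ → ℕ
  | [] => 0
  | x :: t => wt (cnt x l) + hsum l t

def run : List (ℕ × ℕ) → List ℕ → ℕ
  | [], l => 65536 ^ (15 * hsum l l)
  | p :: es, l => getK l p.1 fun la => getK l p.2 fun lb =>
      bif Nat.beq la lb then 65537 * run es l
      else run es l + 65536 * joinK la lb l (run es)

def incHead : List ℕ → List ℕ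
  | [] => [1]
  | x :: t => (x + 1) :: t

def comps : ℕ → List (List ℕ)
  | 0 => [[]]
  | n + 1 => (comps n).map (fun l => 1 :: l) ++ (comps n).map incHead

def hl : List ℕ → ℕ
  | [] => 0
  | x :: t => x * wt x + hl t

theorem hl_eq (l : List ℕ) : hl l = (l.map fun s => s * wt s).sum := by
  induction l with
  | nil => rfl
  | cons x t ih => simp [hl, ih]

theorem mem_comps (n : ℕ) : ∀ l : List ℕ, (∀ x ∈ l, 0 < x) → l.sum = n → l ∈ comps n := by
  induction n with
  | zero =>
    intro l hl hs
    cases l with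
    | nil => simp [comps]
    | cons x t =>
      have := hl x (by simp)
      simp at hs
      omega
  | succ n ih =>
    intro l hl hs
    cases l with
    | nil => simp at hs
    | cons x t =>
      have hx := hl x (by simp)
      simp only [List.sum_cons] at hs
      simp only [comps, List.mem_append, List.mem_map]
      by_cases h1 : x = 1
      · left
        refine ⟨t, ih t (fun y hy => hl y (by simp [hy])) (by omega), by rw [h1]⟩
      · right
        refine ⟨(x - 1) :: t, ih _ ?_ (by simp; omega), ?_⟩
        · intro y hy
          rcases List.mem_cons.1 hy with rfl | hy
          · omega
          · exact hl y (by simp [hy])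
        · simp [incHead]; omega

theorem comps_check : ((comps 8).all fun a => (comps 8).all fun b =>
    bif Nat.beq (hl a) (hl b) then List.isPerm a b else true) = true := by decide +kernel

theorem part_inj (p q : Multiset ℕ) (hp : ∀ x ∈ p, 0 < x) (hq : ∀ x ∈ q, 0 < x)
    (sp : p.sum = 8) (sq : q.sum = 8)
    (h : (p.map fun s => s * wt s).sum = (q.map fun s => s * wt s).sum) : p = q := by
  induction p using Quotient.inductionOn with | _ a =>
  induction q using Quotient.inductionOn with | _ b =>
  simp only [Multiset.quot_mk_to_coe, Multiset.mem_coe, Multiset.sum_coe, Multiset.map_coe] at *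
  have ha := mem_comps 8 a hp sp
  have hb := mem_comps 8 b hq sq
  have hc := List.all_eq_true.1 (List.all_eq_true.1 comps_check a ha) b hb
  rw [← hl_eq, ← hl_eq] at h
  have h' : Nat.beq (hl a) (hl b) = true := by simp [h]
  rw [h', cond_true] at hc
  exact Multiset.coe_eq_coe.2 (List.isPerm_iff.1 hc)

/-- Multisets of exponents with fewer than `B` elements are determined by the sum of powers. -/
theorem pow_inj (B : ℕ) (N : ℕ) : ∀ M M' : Multiset ℕ, (∀ x ∈ M, x < N) → (∀ x ∈ M', x < N) →
    M.card < B → M'.card < B → (M.map (B ^ ·)).sum = (M'.map (B ^ ·)).sum → M = M' := by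
  induction N with
  | zero =>
    intro M M' h h' _ _ _
    have e : M = 0 := Multiset.eq_zero_of_forall_notMem (fun x hx => by simpa using h x hx)
    have e' : M' = 0 := Multiset.eq_zero_of_forall_notMem (fun x hx => by simpa using h' x hx)
    rw [e, e']
  | succ N ih =>
    have dec : ∀ M : Multiset ℕ, ∃ c, ∃ K : Multiset ℕ,
        M = Multiset.replicate c 0 + K.map Nat.succ := by
      intro M
      induction M using Multiset.induction with
      | empty => exact ⟨0, 0, by simp⟩
      | cons x M h =>
        obtain ⟨c, K, rfl⟩ := h
        cases x with
        | zero => exact ⟨c + 1, K, by simp [Multiset.replicate_succ]⟩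
        | succ x => exact ⟨c, x ::ₘ K, by simp⟩
    intro M M' h h' hB hB' hs
    obtain ⟨c, K, rfl⟩ := dec M
    obtain ⟨c', K', rfl⟩ := dec M'
    simp only [Multiset.card_add, Multiset.card_replicate, Multiset.card_map] at hB hB'
    have key : ∀ c (K : Multiset ℕ), ((Multiset.replicate c 0 + K.map Nat.succ).map (B ^ ·)).sum
        = c + B * (K.map (B ^ ·)).sum := by
      intro c K
      simp only [Multiset.map_add, Multiset.sum_add, Multiset.map_replicate, pow_zero,
        Multiset.sum_replicate, smul_eq_mul, mul_one, Multiset.map_map, Function.comp_def,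
        Nat.succ_eq_add_one, pow_succ']
      rw [Multiset.sum_map_mul_left]
    rw [key, key] at hs
    have hc : c = c' := by
      have := congrArg (· % B) hs
      simpa [Nat.add_mul_mod_self_left, Nat.mod_eq_of_lt (show c < B by omega),
        Nat.mod_eq_of_lt (show c' < B by omega)] using this
    subst hc
    have hs' := Nat.eq_of_mul_eq_mul_left (show 0 < B by omega) (Nat.add_left_cancel hs)
    rw [ih K K' (fun x hx => ?_) (fun x hx => ?_) (by omega) (by omega) hs']
    · have := h (x + 1) (by simp [hx])
      omega
    · have := h' (x + 1) (by simp [hx])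
      omega

noncomputable def csize (A : Finset (Sym2 (Fin 8))) (v : Fin 8) : ℕ :=
  Nat.card ((SimpleGraph.fromEdgeSet (A : Set (Sym2 (Fin 8)))).connectedComponentMk v).supp

noncomputable def HH (A : Finset (Sym2 (Fin 8))) : ℕ := ∑ v, wt (csize A v)

theorem comp_sum (A : Finset (Sym2 (Fin 8))) (f : ℕ → ℕ) :
    ((componentOrders (SimpleGraph.fromEdgeSet (A : Set (Sym2 (Fin 8))))).map
      fun s => s * f s).sum = ∑ v, f (csize A v) := by
  unfold csize componentOrders
  set G := SimpleGraph.fromEdgeSet (A : Set (Sym2 (Fin 8)))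
  have := Finset.sum_comp (s := (Finset.univ : Finset (Fin 8)))
    (fun c : G.ConnectedComponent => f (Nat.card c.supp)) G.connectedComponentMk
  rw [this, Multiset.map_map]
  change Finset.sum (Finset.univ.image G.connectedComponentMk) _ = _
  refine Finset.sum_congr rfl fun c _ => ?_
  simp only [Function.comp, smul_eq_mul]
  congr 1
  rw [Nat.card_eq_fintype_card, ← Set.toFinset_card]
  congr 1
  ext v
  simp

theorem comp_pos (A : Finset (Sym2 (Fin 8))) (x : ℕ)
    (hx : x ∈ componentOrders (SimpleGraph.fromEdgeSet (A : Set (Sym2 (Fin 8))))) : 0 < x := by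
  unfold componentOrders at hx
  simp only [Multiset.mem_map, Multiset.mem_dedup] at hx
  obtain ⟨c, ⟨v, _, rfl⟩, rfl⟩ := hx
  have : Nonempty ((SimpleGraph.fromEdgeSet (A : Set (Sym2 (Fin 8)))).connectedComponentMk v).supp :=
    ⟨v, rfl⟩
  exact Nat.card_pos

def lab (l : List ℕ) (v : Fin 8) : ℕ := l.getD v 0

def LabRep (l : List ℕ) (A : Finset (Sym2 (Fin 8))) : Prop :=
  l.length = 8 ∧ ∀ x y, (SimpleGraph.fromEdgeSet (A : Set (Sym2 (Fin 8)))).Reachable x y ↔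
    lab l x = lab l y

theorem beq_t {a b : ℕ} (h : a = b) : Nat.beq a b = true := by
  simp [h]

theorem beq_f {a b : ℕ} (h : ¬ a = b) : Nat.beq a b = false := by
  cases e : Nat.beq a b with
  | false => rfl
  | true => exact absurd (Nat.eq_of_beq_eq_true e) h

theorem getK_eq {α : Type} (l : List ℕ) (n : ℕ) (c : ℕ → α) : getK l n c = c (l.getD n 0) := by
  induction l generalizing n with
  | nil => simp [getK]
  | cons x t ih => cases n <;> simp [getK, ih]

def jn (la lb : ℕ) (l : List ℕ) : List ℕ := l.map fun x => if x = lb then la else x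

theorem joinK_eq {α : Type} (la lb : ℕ) (l : List ℕ) (c : List ℕ → α) :
    joinK la lb l c = c (jn la lb l) := by
  induction l generalizing c with
  | nil => simp [joinK, jn]
  | cons x t ih =>
    by_cases h : x = lb
    · have h' : Nat.beq x lb = true := by simp [h]
      simp only [joinK, h', cond_true, ih]
      simp [jn, h]
    · have h' : Nat.beq x lb = false := beq_f h
      simp only [joinK, h', cond_false, ih]
      simp [jn, h]

theorem jn_self (a : ℕ) (l : List ℕ) : jn a a l = l := by
  unfold jn
  conv_rhs => rw [← List.map_id l]
  apply List.map_congr_left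
  intro x _
  by_cases h : x = a <;> simp [h]

theorem run_cons (p : ℕ × ℕ) (es : List (ℕ × ℕ)) (l : List ℕ) :
    run (p :: es) l = run es l + 65536 * run es (jn (l.getD p.1 0) (l.getD p.2 0) l) := by
  simp only [run, getK_eq, joinK_eq]
  by_cases h : l.getD p.1 0 = l.getD p.2 0
  · have h' : Nat.beq (l.getD p.1 0) (l.getD p.2 0) = true := beq_t h
    rw [h', cond_true, h, jn_self]
    ring
  · have h' : Nat.beq (l.getD p.1 0) (l.getD p.2 0) = false := beq_f h
    rw [h', cond_false]

theorem lab_jn (la lb : ℕ) (l : List ℕ) (hl : l.length = 8) (v : Fin 8) :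
    lab (jn la lb l) v = if lab l v = lb then la else lab l v := by
  have : (v : ℕ) < l.length := by omega
  simp [lab, jn, List.getD_eq_getElem?_getD, this]

theorem rep_step (l : List ℕ) (A : Finset (Sym2 (Fin 8))) (a b : Fin 8) (h : LabRep l A) :
    LabRep (jn (lab l a) (lab l b) l) (insert s(a, b) A) := by
  obtain ⟨hl, hr⟩ := h
  refine ⟨by simp [jn, hl], ?_⟩
  set G' := SimpleGraph.fromEdgeSet ((insert s(a, b) A : Finset _) : Set (Sym2 (Fin 8))) with hG'
  have mono : ∀ x y, lab l x = lab l y → G'.Reachable x y := by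
    intro x y hxy
    refine ((hr x y).2 hxy).mono ?_
    apply SimpleGraph.fromEdgeSet_mono
    simp
  have hab : G'.Reachable a b := by
    by_cases e : a = b
    · rw [e]
    · exact SimpleGraph.Adj.reachable (by simp [hG', e])
  intro x y
  rw [lab_jn _ _ _ hl, lab_jn _ _ _ hl]
  constructor
  · rintro ⟨w⟩
    induction w with
    | nil => rfl
    | cons hadj _ ih =>
      rw [← ih]
      rename_i x y z _
      rw [hG', SimpleGraph.fromEdgeSet_adj] at hadj
      obtain ⟨hm, hne⟩ := hadj
      simp only [Finset.coe_insert, Set.mem_insert_iff, Finset.mem_coe] at hm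
      rcases hm with hm | hm
      · rcases Sym2.eq_iff.1 hm with ⟨rfl, rfl⟩ | ⟨rfl, rfl⟩ <;> simp
      · have : lab l x = lab l y := (hr x y).1
          (SimpleGraph.Adj.reachable (by simp [hm, hne]))
        rw [this]
  · intro h
    split_ifs at h with h1 h2 h2
    · exact mono _ _ (h1.trans h2.symm)
    · exact ((mono _ _ h1).trans hab.symm).trans (mono _ _ h)
    · exact ((mono _ _ h).trans hab).trans (mono _ _ h2.symm)
    · exact mono _ _ h

theorem cnt_eq (y : ℕ) (l : List ℕ) : cnt y l = l.count y := by
  induction l with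
  | nil => rfl
  | cons x t ih =>
    by_cases h : x = y
    · have h' : Nat.beq x y = true := by simp [h]
      simp only [cnt, h', cond_true, ih]
      simp [h]
    · have h' : Nat.beq x y = false := beq_f h
      simp only [cnt, h', cond_false, ih]
      simp [h]

theorem hsum_eq (l t : List ℕ) : hsum l t = (t.map fun x => wt (l.count x)).sum := by
  induction t with
  | nil => rfl
  | cons x t ih => simp [hsum, ih, cnt_eq]

theorem ofFn_lab (l : List ℕ) (hl : l.length = 8) : l = List.ofFn (lab l) := by
  apply List.ext_getElem
  · simp [hl]
  · intro i h1 h2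
    rw [List.getElem_ofFn]
    simp only [lab]
    rw [List.getD_eq_getElem _ _ h1]

theorem hsum_rep (l : List ℕ) (A : Finset (Sym2 (Fin 8))) (h : LabRep l A) : hsum l l = HH A := by
  obtain ⟨hl, hr⟩ := h
  rw [hsum_eq]
  have hcnt : ∀ y, l.count y = (List.ofFn (lab l)).count y :=
    fun y => congrArg (List.count y) (ofFn_lab l hl)
  have hc : ∀ v, csize A v = l.count (lab l v) := by
    intro v
    unfold csize
    rw [Nat.card_eq_fintype_card, ← Set.toFinset_card]
    rw [hcnt, ← Multiset.coe_count, List.ofFn_eq_map, ← Multiset.map_coe, Multiset.count_map]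
    change _ = (Finset.univ.filter fun a => lab l v = lab l a).card
    congr 1
    ext w
    simp only [Set.mem_toFinset, SimpleGraph.ConnectedComponent.mem_supp_iff,
      SimpleGraph.ConnectedComponent.eq, hr, Finset.mem_filter, Finset.mem_univ, true_and]
    exact eq_comm
  unfold HH
  simp only [hc]
  conv_lhs => arg 1; arg 2; rw [ofFn_lab l hl]
  rw [List.map_ofFn, List.sum_ofFn]
  rfl

def toS (p : ℕ × ℕ) : Sym2 (Fin 8) := s(Fin.ofNat 8 p.1, Fin.ofNat 8 p.2)

theorem run_spec (es : List (ℕ × ℕ)) : ∀ (l : List ℕ) (A : Finset (Sym2 (Fin 8))), LabRep l A →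
    (∀ p ∈ es, p.1 < 8 ∧ p.2 < 8) → (es.map toS).Nodup →
    run es l = ∑ F ∈ (es.map toS).toFinset.powerset, 65536 ^ (F.card + 15 * HH (F ∪ A)) := by
  induction es with
  | nil =>
    intro l A h _ _
    simp [run, hsum_rep l A h]
  | cons p es ih =>
    intro l A h hb hn
    obtain ⟨h1, h2⟩ := hb p (by simp)
    have hb' : ∀ p ∈ es, p.1 < 8 ∧ p.2 < 8 := fun q hq => hb q (by simp [hq])
    rw [List.map_cons, List.nodup_cons] at hn
    have e1 : l.getD p.1 0 = lab l (Fin.ofNat 8 p.1) := by simp [lab, Nat.mod_eq_of_lt h1]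
    have e2 : l.getD p.2 0 = lab l (Fin.ofNat 8 p.2) := by simp [lab, Nat.mod_eq_of_lt h2]
    have hrep : LabRep (jn (lab l (Fin.ofNat 8 p.1)) (lab l (Fin.ofNat 8 p.2)) l)
        (insert (toS p) A) := rep_step l A _ _ h
    rw [run_cons, e1, e2, ih l A h hb' hn.2, ih _ _ hrep hb' hn.2,
      List.map_cons, List.toFinset_cons, Finset.sum_powerset_insert (by simpa using hn.1),
      Finset.mul_sum]
    generalize (65536 : ℕ) = B
    rw [Nat.add_left_cancel_iff]
    refine Finset.sum_congr rfl fun F hF => ?_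
    have hnF : toS p ∉ F := fun hm => hn.1 (List.mem_toFinset.1 (Finset.mem_powerset.1 hF hm))
    rw [Finset.card_insert_of_notMem hnF, Finset.insert_union, Finset.union_insert]
    rw [← pow_succ', Nat.add_right_comm]

theorem rep_init : LabRep [0,1,2,3,4,5,6,7] ∅ := by
  refine ⟨rfl, ?_⟩
  intro x y
  simp only [Finset.coe_empty, SimpleGraph.fromEdgeSet_empty, SimpleGraph.reachable_bot]
  revert x y
  decide

noncomputable def desc (F : Finset (Sym2 (Fin 8))) : ℕ × Multiset ℕ :=
  (F.card, componentOrders (SimpleGraph.fromEdgeSet (F : Set (Sym2 (Fin 8)))))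

def code (x : ℕ × Multiset ℕ) : ℕ := x.1 + 15 * (x.2.map fun s => s * wt s).sum

def good : Set (ℕ × Multiset ℕ) := {x | x.1 < 15 ∧ (∀ s ∈ x.2, 0 < s) ∧ x.2.sum = 8}

theorem code_injOn : Set.InjOn code good := by
  rintro ⟨k, m⟩ ⟨h1, h2, h3⟩ ⟨k', m'⟩ ⟨h1', h2', h3'⟩ h
  simp only [code] at *
  have e : k = k' := by omega
  have e' := part_inj m m' h2 h2' h3 h3' (by omega)
  rw [e, e']

theorem code_desc (F : Finset (Sym2 (Fin 8))) : code (desc F) = F.card + 15 * HH F := by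
  simp only [code, desc, comp_sum]
  rfl

theorem desc_good (F : Finset (Sym2 (Fin 8))) (h : F.card < 15) : desc F ∈ good := by
  refine ⟨h, comp_pos F, ?_⟩
  have := comp_sum F (fun _ => 1)
  simpa [desc] using this

theorem seq_eq (S T : Finset (Sym2 (Fin 8))) (hS : S.card = 14) (hT : T.card = 14)
    (h : ∑ F ∈ S.powerset, 65536 ^ (F.card + 15 * HH F)
      = ∑ F ∈ T.powerset, 65536 ^ (F.card + 15 * HH F)) :
    S.powerset.val.map desc = T.powerset.val.map desc := by
  have key : (S.powerset.val.map desc).map code = (T.powerset.val.map desc).map code := by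
    have bd : ∀ M : Multiset ℕ, ∀ x ∈ M, x ≤ M.sum := fun M x hx => Multiset.le_sum_of_mem hx
    refine pow_inj 65536 (((S.powerset.val.map desc).map code).sum +
      ((T.powerset.val.map desc).map code).sum + 1) _ _ (fun x hx => ?_) (fun x hx => ?_) ?_ ?_ ?_
    · have := bd _ x hx
      omega
    · have := bd _ x hx
      omega
    · rw [Multiset.card_map, Multiset.card_map, Finset.card_val, Finset.card_powerset, hS]
      norm_num
    · rw [Multiset.card_map, Multiset.card_map, Finset.card_val, Finset.card_powerset, hT]
      norm_num
    · simp only [Multiset.map_map, Function.comp_def, code_desc]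
      exact h
  have inv : ∀ U : Finset (Sym2 (Fin 8)), U.card = 14 →
      ((U.powerset.val.map desc).map code).map (Function.invFunOn code good)
        = U.powerset.val.map desc := by
    intro U hU
    simp only [Multiset.map_map]
    refine Multiset.map_congr rfl fun F hF => ?_
    have hc := Finset.card_le_card (Finset.mem_powerset.1 hF)
    exact code_injOn.leftInvOn_invFunOn (desc_good F (by omega))
  rw [← inv S hS, ← inv T hT, key]

theorem seq_of (E : List (ℕ × ℕ)) (G : SimpleGraph (Fin 8))
    (h : ∀ x y, G.Adj x y ↔ s(x, y) ∈ E.map toS) :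
    subgraphSeq G = (E.map toS).toFinset.powerset.val.map desc := by
  unfold subgraphSeq
  have : G.edgeFinset = (E.map toS).toFinset := by
    ext e
    induction e using Sym2.ind with
    | _ x y => rw [SimpleGraph.mem_edgeFinset, SimpleGraph.mem_edgeSet, List.mem_toFinset, h]
  rw [this]
  rfl

def adjB (E : List (ℕ × ℕ)) (x y : Fin 8) : Bool := decide (s(x, y) ∈ E.map toS)

def GG : SimpleGraph (Fin 8) where
  Adj x y := adjB E1 x y = true
  symm := ⟨by decide +kernel⟩
  loopless := ⟨by decide +kernel⟩

theorem compl_adj' : ∀ x y, GGᶜ.Adj x y ↔ adjB E2 x y = true := by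
  intro x y
  rw [SimpleGraph.compl_adj]
  change (x ≠ y ∧ ¬ adjB E1 x y = true) ↔ _
  revert x y
  decide +kernel

def degB (E : List (ℕ × ℕ)) (x : Fin 8) : ℕ := ∑ y, if adjB E x y = true then 1 else 0

theorem tri_one : adjB E1 0 1 = true ∧ adjB E1 0 7 = true ∧ adjB E1 1 7 = true ∧
    degB E1 0 = 5 ∧ degB E1 1 = 5 ∧ degB E1 7 = 2 := by decide +kernel

theorem tri_two : ∀ x y z, ¬ (adjB E2 x y = true ∧ adjB E2 x z = true ∧ adjB E2 y z = true ∧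
    degB E2 x = 5 ∧ degB E2 y = 5 ∧ degB E2 z = 2) := by decide +kernel

theorem run_eq : Nat.beq (run E1 [0,1,2,3,4,5,6,7]) (run E2 [0,1,2,3,4,5,6,7]) = true := by
  decide +kernel

/-- There is a graph on 8 vertices that is not isomorphic to its complement but has the
same subgraph sequence as its complement. -/
theorem stmt_8 :
    ∃ G : SimpleGraph (Fin 8),
      ¬ Nonempty (G ≃g Gᶜ) ∧ subgraphSeq G = subgraphSeq Gᶜ := by
  refine ⟨GG, ?_, ?_⟩
  · rintro ⟨φ⟩
    have hadj : ∀ x y, adjB E2 (φ x) (φ y) = true ↔ adjB E1 x y = true := by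
      intro x y
      rw [← compl_adj', φ.map_adj_iff]
      rfl
    have hdeg : ∀ x, degB E2 (φ x) = degB E1 x := by
      intro x
      unfold degB
      rw [← Equiv.sum_comp φ.toEquiv]
      refine Finset.sum_congr rfl fun y _ => ?_
      exact if_congr (hadj x y) rfl rfl
    obtain ⟨h1, h2, h3, h4, h5, h6⟩ := tri_one
    exact tri_two (φ 0) (φ 1) (φ 7) ⟨(hadj _ _).2 h1, (hadj _ _).2 h2, (hadj _ _).2 h3,
      (hdeg _).trans h4, (hdeg _).trans h5, (hdeg _).trans h6⟩
  · have n1 : (E1.map toS).Nodup := by decide +kernel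
    have n2 : (E2.map toS).Nodup := by decide +kernel
    rw [seq_of E1 GG (fun x y => by
        change adjB E1 x y = true ↔ _
        simp [adjB]),
      seq_of E2 GGᶜ (fun x y => by rw [compl_adj']; simp [adjB])]
    refine seq_eq _ _ ?_ ?_ ?_
    · rw [List.toFinset_card_of_nodup n1]
      rfl
    · rw [List.toFinset_card_of_nodup n2]
      rfl
    · have r1 := run_spec E1 _ ∅ rep_init (by decide) n1
      have r2 := run_spec E2 _ ∅ rep_init (by decide) n2
      simp only [Finset.union_empty] at r1 r2
      rw [← r1, ← r2]
      exact Nat.eq_of_beq_eq_true run_eq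
end

section
/- There exists a finite simple graph G on 8 vertices such that G is not isomorphic to its complement G̅, yet G and G̅ have the same Tutte polynomial: for all real numbers x and y, Σ_{F ⊆ E(G)} (x−1)^{c(F)−c(E(G))}·(y−1)^{c(F)+|F|−8} = Σ_{F ⊆ E(G̅)} (x−1)^{c(F)−c(E(G̅))}·(y−1)^{c(F)+|F|−8}. -/
open SimpleGraph

open scoped Classical

/-- `c(F)`: the number of connected components of the spanning subgraph `(V, F)`. -/

noncomputable def numComponents {V : Type*} [Fintype V] (F : Finset (Sym2 V)) : ℕ :=
  Nat.card (SimpleGraph.fromEdgeSet (F : Set (Sym2 V))).ConnectedComponent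

/-- The Tutte polynomial of `G`, evaluated at `(x, y)`:
`T_G(x,y) = Σ_{F ⊆ E(G)} (x−1)^(c(F)−c(E)) * (y−1)^(c(F)+|F|−|V|)`. -/

noncomputable def tutte {V : Type*} [Fintype V] (G : SimpleGraph V) (x y : ℝ) : ℝ :=
  ∑ F ∈ G.edgeFinset.powerset,
    (x - 1) ^ (numComponents F - numComponents G.edgeFinset) *
      (y - 1) ^ (numComponents F + F.card - Fintype.card V)

namespace TutteAux

/-- Merge the classes of `a` and `b` in a labelling. -/
def merge (l : Fin 8 → ℕ) (a b : Fin 8) : Fin 8 → ℕ :=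
  fun v => bif Nat.beq (l v) (l b) then l a else l v

/-- Deletion-contraction evaluation of `∑ X ^ rank * Y ^ card`. -/
def dc (X Y : ℕ) : List (Fin 8 × Fin 8) → (Fin 8 → ℕ) → ℕ
  | [], _ => 1
  | e :: L, l => bif Nat.beq (l e.1) (l e.2) then (1 + Y) * dc X Y L l
      else dc X Y L l + X * Y * dc X Y L (merge l e.1 e.2)

def L1 : List (Fin 8 × Fin 8) :=
  [(0,1),(0,2),(0,4),(0,5),(1,4),(1,7),(2,3),(2,5),(2,6),(2,7),(3,4),(3,6),(4,5),(5,6)]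

def L2 : List (Fin 8 × Fin 8) :=
  [(0,3),(0,6),(0,7),(1,2),(1,3),(1,5),(1,6),(2,4),(3,5),(3,7),(4,6),(4,7),(5,7),(6,7)]

theorem dc_eq : dc (2 ^ 15) (2 ^ 120) L1 Fin.val = dc (2 ^ 15) (2 ^ 120) L2 Fin.val := by
  decide +kernel

/-- `l` labels exactly the components of the graph with edge set `A`. -/
def Rep (l : Fin 8 → ℕ) (A : Finset (Sym2 (Fin 8))) : Prop :=
  ∀ u v, l u = l v ↔ (SimpleGraph.fromEdgeSet (A : Set (Sym2 (Fin 8)))).Reachable u v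

theorem merge_apply (l : Fin 8 → ℕ) (a b v : Fin 8) :
    merge l a b v = if l v = l b then l a else l v := by
  unfold merge
  by_cases h : l v = l b
  · simp [h]
  · have : Nat.beq (l v) (l b) = false := by
      rw [← Bool.not_eq_true, Nat.beq_eq]; exact h
    simp [h, this]

theorem reach_le_of_adj (l : Fin 8 → ℕ) (H : SimpleGraph (Fin 8))
    (h : ∀ u v, H.Adj u v → l u = l v) (u v : Fin 8) (hr : H.Reachable u v) : l u = l v := by
  obtain ⟨w⟩ := hr
  induction w with
  | nil => rfl
  | cons hadj _ ih => exact (h _ _ hadj).trans ih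

theorem rep_empty : Rep Fin.val ∅ := by
  intro u v
  constructor
  · intro h
    rw [Fin.ext h]
  · intro h
    refine reach_le_of_adj _ _ ?_ u v h
    intro a b hab
    simp at hab

theorem rep_insert {l : Fin 8 → ℕ} {A : Finset (Sym2 (Fin 8))} (h : Rep l A) (a b : Fin 8) :
    Rep (merge l a b) (insert s(a, b) A) := by
  have hle : SimpleGraph.fromEdgeSet (A : Set (Sym2 (Fin 8))) ≤
      SimpleGraph.fromEdgeSet ((insert s(a, b) A : Finset (Sym2 (Fin 8))) : Set (Sym2 (Fin 8))) := by
    apply SimpleGraph.fromEdgeSet_mono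
    simp
  have hab : (SimpleGraph.fromEdgeSet
      ((insert s(a, b) A : Finset (Sym2 (Fin 8))) : Set (Sym2 (Fin 8)))).Reachable a b := by
    by_cases hab : a = b
    · rw [hab]
    · apply SimpleGraph.Adj.reachable
      simp [hab]
  have hm : ∀ u v, l u = l v → (SimpleGraph.fromEdgeSet
      ((insert s(a, b) A : Finset (Sym2 (Fin 8))) : Set (Sym2 (Fin 8)))).Reachable u v :=
    fun u v huv => ((h u v).1 huv).mono hle
  intro u v
  constructor
  · rw [merge_apply, merge_apply]
    split_ifs with h1 h2 h2
    · intro _; exact hm _ _ (h1.trans h2.symm)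
    · intro h3; exact (hm _ _ h1).trans (hab.symm.trans (hm _ _ h3))
    · intro h3; exact (hm _ _ h3).trans (hab.trans (hm _ _ h2.symm))
    · exact hm _ _
  · refine reach_le_of_adj _ _ ?_ u v
    intro p q hpq
    rw [merge_apply, merge_apply]
    simp only [Finset.coe_insert, SimpleGraph.fromEdgeSet_adj, Set.mem_insert_iff,
      Finset.mem_coe] at hpq
    obtain ⟨h1 | h1, h2⟩ := hpq
    · rw [Sym2.eq_iff] at h1
      rcases h1 with ⟨rfl, rfl⟩ | ⟨rfl, rfl⟩ <;> simp
    · have : l p = l q := (h p q).2 (SimpleGraph.Adj.reachable (by simp [h1, h2]))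
      rw [this]

theorem rep_insert_same {l : Fin 8 → ℕ} {A : Finset (Sym2 (Fin 8))} (h : Rep l A) (a b : Fin 8)
    (hab : l a = l b) : Rep l (insert s(a, b) A) := by
  have := rep_insert h a b
  have e : merge l a b = l := by
    funext v
    rw [merge_apply]
    split_ifs with h1
    · rw [h1, hab]
    · rfl
  rwa [e] at this

theorem rep_card {l : Fin 8 → ℕ} {A : Finset (Sym2 (Fin 8))} (h : Rep l A) :
    numComponents A = (Finset.univ.image l).card := by
  unfold numComponents
  have hr : (Finset.univ.image l).card = Nat.card (Set.range l) := by
    rw [Nat.card_coe_set_eq, ← Set.ncard_coe_finset]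
    simp
  rw [hr]
  refine Nat.card_congr (Equiv.ofBijective
    (fun c => c.lift (fun v => (⟨l v, v, rfl⟩ : Set.range l)) ?_) ⟨?_, ?_⟩)
  · intro u v p _
    exact Subtype.ext ((h u v).2 ⟨p⟩)
  · intro c d
    induction c using SimpleGraph.ConnectedComponent.ind
    induction d using SimpleGraph.ConnectedComponent.ind
    intro hcd
    simp only [SimpleGraph.ConnectedComponent.lift_mk] at hcd
    exact SimpleGraph.ConnectedComponent.eq.2 ((h _ _).1 (Subtype.ext_iff.1 hcd))
  · rintro ⟨_, v, rfl⟩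
    exact ⟨SimpleGraph.connectedComponentMk _ v, rfl⟩

theorem card_merge (l : Fin 8 → ℕ) (a b : Fin 8) (hab : l a ≠ l b) :
    (Finset.univ.image l).card = (Finset.univ.image (merge l a b)).card + 1 := by
  have : Finset.univ.image (merge l a b) = (Finset.univ.image l).erase (l b) := by
    ext x
    simp only [Finset.mem_image, Finset.mem_univ, true_and, Finset.mem_erase, merge_apply]
    constructor
    · rintro ⟨v, rfl⟩
      split_ifs with h
      · exact ⟨hab, a, rfl⟩
      · exact ⟨h, v, rfl⟩
    · rintro ⟨h, v, rfl⟩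
      exact ⟨v, by simp [h]⟩
  rw [this, Finset.card_erase_add_one]
  simp

theorem card_le (l : Fin 8 → ℕ) : (Finset.univ.image l).card ≤ 8 :=
  Finset.card_image_le.trans (by simp)

def toS (L : List (Fin 8 × Fin 8)) : List (Sym2 (Fin 8)) := L.map (fun e => s(e.1, e.2))

theorem dc_spec (X Y : ℕ) (L : List (Fin 8 × Fin 8)) : ∀ (l : Fin 8 → ℕ)
    (A : Finset (Sym2 (Fin 8))), Rep l A → (toS L).Nodup →
    X ^ (8 - numComponents A) * dc X Y L l =
      ∑ S ∈ (toS L).toFinset.powerset, X ^ (8 - numComponents (A ∪ S)) * Y ^ S.card := by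
  induction L with
  | nil => intro l A _ _; simp [toS, dc]
  | cons e L ih =>
    intro l A hA hnd
    have hnd' : s(e.1, e.2) ∉ (toS L) ∧ (toS L).Nodup := List.nodup_cons.1 hnd
    have hne : s(e.1, e.2) ∉ (toS L).toFinset := by simpa using hnd'.1
    have hS : (toS (e :: L)).toFinset = insert s(e.1, e.2) (toS L).toFinset := by
      simp [toS]
    rw [hS, Finset.sum_powerset_insert hne, ← ih l A hA hnd'.2]
    have h2 : ∑ S ∈ (toS L).toFinset.powerset,
        X ^ (8 - numComponents (A ∪ insert s(e.1, e.2) S)) *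
          Y ^ (insert s(e.1, e.2) S).card =
        Y * ∑ S ∈ (toS L).toFinset.powerset,
        X ^ (8 - numComponents ((insert s(e.1, e.2) A) ∪ S)) * Y ^ S.card := by
      rw [Finset.mul_sum]
      refine Finset.sum_congr rfl fun S hSm => ?_
      have : s(e.1, e.2) ∉ S := fun h => hne (Finset.mem_powerset.1 hSm h)
      rw [Finset.card_insert_of_notMem this, Finset.union_insert, Finset.insert_union]
      ring
    rw [h2]
    by_cases hl : l e.1 = l e.2
    · have hA' := rep_insert_same hA _ _ hl
      rw [← ih l _ hA' hnd'.2, rep_card hA', rep_card hA]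
      simp only [dc, hl, Nat.beq_refl, cond_true]
      ring
    · have hA' := rep_insert hA e.1 e.2
      have hb : Nat.beq (l e.1) (l e.2) = false := by
        rw [← Bool.not_eq_true, Nat.beq_eq]; exact hl
      have hc := card_merge l _ _ hl
      have h8 := card_le l
      rw [← ih _ _ hA' hnd'.2, rep_card hA', rep_card hA]
      have : 8 - (Finset.univ.image (merge l e.1 e.2)).card =
          8 - (Finset.univ.image l).card + 1 := by omega
      rw [this]
      simp only [dc, hb, cond_false]
      ring

theorem digits_sum {ι : Type*} (s : Finset ι) (g : ι → ℕ) (B N : ℕ) (hg : ∀ i ∈ s, g i < N) :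
    ∑ i ∈ s, B ^ g i =
      Nat.ofDigits B ((List.range N).map (fun j => (s.filter (fun i => g i = j)).card)) := by
  rw [Nat.ofDigits_eq_sum_mapIdx, List.mapIdx_eq_ofFn, List.sum_ofFn]
  have h := Finset.sum_fiberwise_of_maps_to (s := s) (t := Finset.range N) (g := g)
    (fun i hi => Finset.mem_range.2 (hg i hi)) (fun i => B ^ g i)
  rw [← h, Finset.sum_range]
  refine Fintype.sum_equiv (finCongr (by simp)) _ _ ?_
  intro j
  rw [Finset.sum_congr rfl (g := fun _ => B ^ (j : ℕ))]
  · simp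
  · intro i hi
    rw [(Finset.mem_filter.1 hi).2]

theorem sum_eq_of_pow {ι : Type*} (s t : Finset ι) (g : ι → ℕ) (B N : ℕ) (hB : 1 < B)
    (hs : ∀ i ∈ s, g i < N) (ht : ∀ i ∈ t, g i < N) (hsB : s.card < B) (htB : t.card < B)
    (h : ∑ i ∈ s, B ^ g i = ∑ i ∈ t, B ^ g i) (f : ℕ → ℝ) :
    ∑ i ∈ s, f (g i) = ∑ i ∈ t, f (g i) := by
  rw [digits_sum s g B N hs, digits_sum t g B N ht] at h
  have h' := Nat.ofDigits_inj_of_len_eq hB (by simp) (by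
    intro d hd
    obtain ⟨j, _, rfl⟩ := List.mem_map.1 hd
    exact (Finset.card_filter_le _ _).trans_lt hsB) (by
    intro d hd
    obtain ⟨j, _, rfl⟩ := List.mem_map.1 hd
    exact (Finset.card_filter_le _ _).trans_lt htB) h
  rw [← Finset.sum_fiberwise_of_maps_to (s := s) (t := Finset.range N) (g := g)
      (fun i hi => Finset.mem_range.2 (hs i hi)) (fun i => f (g i)),
    ← Finset.sum_fiberwise_of_maps_to (s := t) (t := Finset.range N) (g := g)
      (fun i hi => Finset.mem_range.2 (ht i hi)) (fun i => f (g i))]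
  refine Finset.sum_congr rfl fun j hj => ?_
  have hc := List.map_inj_left.1 h' j (by simpa using hj)
  rw [Finset.sum_congr rfl (g := fun _ => f j), Finset.sum_congr (s₁ := t.filter _) rfl (g := fun _ => f j)]
  · rw [Finset.sum_const, Finset.sum_const, hc]
  · intro i hi
    rw [(Finset.mem_filter.1 hi).2]
  · intro i hi
    rw [(Finset.mem_filter.1 hi).2]

theorem numComponents_pos (A : Finset (Sym2 (Fin 8))) : 1 ≤ numComponents A := by
  unfold numComponents
  have : Nonempty (SimpleGraph.fromEdgeSet (A : Set (Sym2 (Fin 8)))).ConnectedComponent :=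
    ⟨SimpleGraph.connectedComponentMk _ 0⟩
  exact Nat.card_pos

theorem numComponents_le (A : Finset (Sym2 (Fin 8))) : numComponents A ≤ 8 := by
  unfold numComponents
  have := Nat.card_le_card_of_surjective
    (SimpleGraph.connectedComponentMk (SimpleGraph.fromEdgeSet (A : Set (Sym2 (Fin 8)))))
    (fun c => c.exists_rep)
  simpa using this

def E1 : Finset (Sym2 (Fin 8)) := (toS L1).toFinset
def E2 : Finset (Sym2 (Fin 8)) := (toS L2).toFinset

theorem nd1 : (toS L1).Nodup := by decide +kernel
theorem nd2 : (toS L2).Nodup := by decide +kernel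

theorem card1 : E1.card = 14 := by
  unfold E1; rw [List.toFinset_card_of_nodup nd1]; rfl
theorem card2 : E2.card = 14 := by
  unfold E2; rw [List.toFinset_card_of_nodup nd2]; rfl

/-- combined exponent -/
noncomputable def gg (F : Finset (Sym2 (Fin 8))) : ℕ := (8 - numComponents F) + 8 * F.card

theorem pow_sum (L : List (Fin 8 × Fin 8)) (h : (toS L).Nodup) :
    dc (2 ^ 15) (2 ^ 120) L Fin.val = ∑ F ∈ (toS L).toFinset.powerset, (2 ^ 15) ^ gg F := by
  have h0 := dc_spec (2 ^ 15) (2 ^ 120) L Fin.val ∅ rep_empty h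
  have h8 : numComponents (∅ : Finset (Sym2 (Fin 8))) = 8 := by
    rw [rep_card rep_empty, Finset.card_image_of_injective _ Fin.val_injective]; simp
  rw [h8, Nat.sub_self, pow_zero, one_mul] at h0
  rw [h0]
  refine Finset.sum_congr rfl fun S _ => ?_
  rw [Finset.empty_union, gg, pow_add, pow_mul _ 8, ← pow_mul 2 15 8]

theorem gg_lt (E F : Finset (Sym2 (Fin 8))) (hE : E.card = 14) (hF : F ∈ E.powerset) :
    gg F < 120 := by
  have := Finset.card_le_card (Finset.mem_powerset.1 hF)
  have := numComponents_pos F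
  unfold gg
  omega

theorem sum_general (f : ℕ → ℝ) :
    ∑ F ∈ E1.powerset, f (gg F) = ∑ F ∈ E2.powerset, f (gg F) := by
  refine sum_eq_of_pow _ _ gg (2 ^ 15) 120 (by norm_num) (fun F hF => gg_lt _ F card1 hF)
    (fun F hF => gg_lt _ F card2 hF) ?_ ?_ ?_ f
  · rw [Finset.card_powerset, card1]; norm_num
  · rw [Finset.card_powerset, card2]; norm_num
  · have := dc_eq
    rwa [pow_sum _ nd1, pow_sum _ nd2] at this

def G : SimpleGraph (Fin 8) := SimpleGraph.fromEdgeSet (E1 : Set (Sym2 (Fin 8)))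

theorem adj1 (u v : Fin 8) : G.Adj u v ↔ s(u, v) ∈ toS L1 := by
  have h : ∀ u v : Fin 8, s(u, v) ∈ toS L1 → u ≠ v := by decide +kernel
  simp only [G, E1, SimpleGraph.fromEdgeSet_adj, List.coe_toFinset, Set.mem_ofPred_eq]
  exact ⟨fun h => h.1, fun h' => ⟨h', h u v h'⟩⟩

theorem adj2 (u v : Fin 8) : Gᶜ.Adj u v ↔ s(u, v) ∈ toS L2 := by
  rw [SimpleGraph.compl_adj, adj1]
  revert u v
  decide +kernel

theorem tutte_formula (H : SimpleGraph (Fin 8)) (E : Finset (Sym2 (Fin 8)))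
    (hE : H.edgeFinset = E) (hc : numComponents E = 1) (x y : ℝ) :
    tutte H x y = ∑ F ∈ E.powerset,
      (fun n => (x - 1) ^ (8 - n % 8 - 1) * (y - 1) ^ (8 - n % 8 + n / 8 - 8)) (gg F) := by
  unfold _root_.tutte
  rw [hE, hc]
  refine Finset.sum_congr rfl fun F _ => ?_
  have h1 := numComponents_pos F
  have h2 := numComponents_le F
  have h3 : 8 - gg F % 8 = numComponents F := by unfold gg; omega
  have h4 : gg F / 8 = F.card := by unfold gg; omega
  simp only [h3, h4, Fintype.card_fin]

theorem edge1 : G.edgeFinset = E1 := by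
  ext e
  induction e using Sym2.ind with
  | _ u v => rw [SimpleGraph.mem_edgeFinset, SimpleGraph.mem_edgeSet, adj1, E1, List.mem_toFinset]

theorem edge2 : Gᶜ.edgeFinset = E2 := by
  ext e
  induction e using Sym2.ind with
  | _ u v => rw [SimpleGraph.mem_edgeFinset, SimpleGraph.mem_edgeSet, adj2, E2, List.mem_toFinset]

/-- the final labelling after merging along all edges of a list -/
def mergeAll : List (Fin 8 × Fin 8) → (Fin 8 → ℕ) → (Fin 8 → ℕ)
  | [], l => l
  | e :: L, l => mergeAll L (merge l e.1 e.2)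

theorem rep_all (L : List (Fin 8 × Fin 8)) : ∀ l A, Rep l A →
    Rep (mergeAll L l) (A ∪ (toS L).toFinset) := by
  induction L with
  | nil => intro l A h; simpa [mergeAll, toS] using h
  | cons e L ih =>
    intro l A h
    have := ih _ _ (rep_insert h e.1 e.2)
    have e1 : A ∪ (toS (e :: L)).toFinset = insert s(e.1, e.2) A ∪ (toS L).toFinset := by
      simp [toS]
    rw [e1]
    exact this

theorem conn1 : numComponents E1 = 1 := by
  have := rep_card (rep_all L1 _ _ rep_empty)
  rw [Finset.empty_union] at this
  rw [E1, this]
  decide +kernel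

theorem conn2 : numComponents E2 = 1 := by
  have := rep_card (rep_all L2 _ _ rep_empty)
  rw [Finset.empty_union] at this
  rw [E2, this]
  decide +kernel

theorem not_iso : ¬ Nonempty (G ≃g Gᶜ) := by
  rintro ⟨φ⟩
  have key : ∀ v w : Fin 8,
      (Finset.univ.filter (fun u => s(v, u) ∈ toS L1)).card = 
      (Finset.univ.filter (fun u => s(φ v, u) ∈ toS L2)).card := by
    intro v _
    refine Finset.card_bij (fun u _ => φ u) ?_ (fun a _ b _ h => φ.injective h) ?_
    · intro u hu
      simp only [Finset.mem_filter, Finset.mem_univ, true_and] at hu ⊢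
      rw [← adj2, φ.map_adj_iff, adj1]
      exact hu
    · intro u hu
      simp only [Finset.mem_filter, Finset.mem_univ, true_and] at hu
      refine ⟨φ.symm u, ?_, by simp⟩
      simp only [Finset.mem_filter, Finset.mem_univ, true_and]
      rw [← adj1, ← φ.map_adj_iff, adj2]
      simpa using hu
  have d2 : ∀ w : Fin 8, (Finset.univ.filter (fun u => s((2 : Fin 8), u) ∈ toS L1)).card =
      (Finset.univ.filter (fun u => s(w, u) ∈ toS L2)).card → w = 7 := by decide +kernel
  have d7 : ∀ w : Fin 8, (Finset.univ.filter (fun u => s((7 : Fin 8), u) ∈ toS L1)).card =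
      (Finset.univ.filter (fun u => s(w, u) ∈ toS L2)).card → w = 2 := by decide +kernel
  have h2 := d2 _ (key 2 0)
  have h7 := d7 _ (key 7 0)
  have hadj : G.Adj 2 7 := (adj1 2 7).2 (by decide +kernel)
  have := φ.map_adj_iff.2 hadj
  rw [h2, h7, adj2] at this
  revert this
  decide +kernel

end TutteAux

/-- There is a graph on 8 vertices that is not isomorphic to its complement but has the
same Tutte polynomial as its complement. -/
theorem stmt_9 :
    ∃ G : SimpleGraph (Fin 8),
      ¬ Nonempty (G ≃g Gᶜ) ∧ ∀ x y : ℝ, tutte G x y = tutte Gᶜ x y := by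
  refine ⟨TutteAux.G, TutteAux.not_iso, fun x y => ?_⟩
  rw [TutteAux.tutte_formula _ _ TutteAux.edge1 TutteAux.conn1,
    TutteAux.tutte_formula _ _ (by convert TutteAux.edge2) TutteAux.conn2]
  exact TutteAux.sum_general
    (fun n => (x - 1) ^ (8 - n % 8 - 1) * (y - 1) ^ (8 - n % 8 + n / 8 - 8))
end

section
/- For every natural number N there exists a finite simple graph G with more than N vertices such that G is not isomorphic to its complement G̅, yet s(G) = s(G̅). -/
open SimpleGraph

open scoped Classical

namespace SubSeq

/-- indicator of a proposition -/
noncomputable def ind (p : Prop) : ℕ := if p then 1 else 0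

lemma ind_true {p : Prop} (h : p) : ind p = 1 := if_pos h

lemma ind_false {p : Prop} (h : ¬ p) : ind p = 0 := if_neg h

lemma ind_tt : ind True = 1 := if_pos trivial

lemma ind_ff : ind False = 0 := if_neg id

/-- sizes of colour classes -/
noncomputable def cnt {V C : Type} [Fintype V] (f : V → C) (i : C) : ℕ :=
  ∑ v, ind (f v = i)

/-- number of ordered monochromatic adjacent pairs -/
noncomputable def pm {V C : Type} [Fintype V] (G : SimpleGraph V) (f : V → C) : ℕ :=
  ∑ u, ∑ v, ind (G.Adj u v ∧ f u = f v)

/-- equality of the joint statistics of colour class sizes and monochromatic edges -/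
def UEq {V W : Type} [Fintype V] [Fintype W] [DecidableEq V] [DecidableEq W]
    (G : SimpleGraph V) (H : SimpleGraph W) : Prop :=
  ∀ (k : ℕ) (Ψ : (Fin k → ℕ) → ℕ → ℤ),
    ∑ f : V → Fin k, Ψ (cnt f) (pm G f) = ∑ f : W → Fin k, Ψ (cnt f) (pm H f)

lemma cnt_comp {V W C : Type} [Fintype V] [Fintype W] (e : V ≃ W) (f : W → C) :
    cnt (fun v => f (e v)) = cnt f := by
  funext i
  unfold cnt
  exact Equiv.sum_comp e (fun w => ind (f w = i))

lemma pm_comp {V W C : Type} [Fintype V] [Fintype W] (G : SimpleGraph V) (H : SimpleGraph W)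
    (e : G ≃g H) (f : W → C) :
    pm G (fun v => f (e v)) = pm H f := by
  unfold pm
  rw [← Equiv.sum_comp e.toEquiv]
  refine Finset.sum_congr rfl fun u _ => ?_
  rw [← Equiv.sum_comp e.toEquiv]
  refine Finset.sum_congr rfl fun v _ => ?_
  have : H.Adj (e.toEquiv u) (e.toEquiv v) ↔ G.Adj u v := e.map_rel_iff
  rw [this]
  rfl

lemma sum_reindex {V W C : Type} [Fintype V] [Fintype W] [Fintype C] [DecidableEq V] [DecidableEq W]
    (e : V ≃ W)
    (Φ : (V → C) → ℤ) :
    ∑ f : V → C, Φ f = ∑ f : W → C, Φ (fun v => f (e v)) :=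
  (Equiv.sum_comp (e.symm.arrowCongr (Equiv.refl C)) Φ).symm

lemma UEq.of_iso {V W : Type} [Fintype V] [Fintype W] [DecidableEq V] [DecidableEq W]
    {G : SimpleGraph V} {H : SimpleGraph W}
    (e : G ≃g H) : UEq G H := by
  intro k Ψ
  rw [sum_reindex e.toEquiv]
  refine Finset.sum_congr rfl fun f _ => ?_
  rw [cnt_comp, ← pm_comp G H e]
  rfl

lemma UEq.trans {V W U : Type} [Fintype V] [Fintype W] [Fintype U] [DecidableEq V]
    [DecidableEq W] [DecidableEq U] {G : SimpleGraph V}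
    {H : SimpleGraph W} {K : SimpleGraph U} (h : UEq G H) (h2 : UEq H K) : UEq G K :=
  fun k Ψ => (h k Ψ).trans (h2 k Ψ)

/-! ### The extension by a path on four vertices -/

/-- adjacency of the path 0 - 1 - 2 - 3 -/
def padj (i j : Fin 4) : Prop := i.val + 1 = j.val ∨ j.val + 1 = i.val

/-- adjacency of the extended graph -/
def extAdj {V : Type} (G : SimpleGraph V) : V ⊕ Fin 4 → V ⊕ Fin 4 → Prop
  | .inl u, .inl v => G.Adj u v
  | .inl _, .inr j => j = 1 ∨ j = 2
  | .inr i, .inl _ => i = 1 ∨ i = 2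
  | .inr i, .inr j => padj i j

/-- the extension: a path on four vertices, whose two inner vertices are joined to `G` -/
def ext {V : Type} (G : SimpleGraph V) : SimpleGraph (V ⊕ Fin 4) where
  Adj := extAdj G
  symm := ⟨by
    rintro (u | i) (v | j) h
    · exact SimpleGraph.Adj.symm h
    · exact h
    · exact h
    · exact Or.symm h⟩
  loopless := ⟨by
    rintro (u | i) h
    · exact G.loopless.irrefl u h
    · rcases h with h | h <;> omega⟩

/-- the antiautomorphism of the path -/
def tau : Equiv.Perm (Fin 4) where
  toFun := ![1, 3, 0, 2]
  invFun := ![2, 0, 3, 1]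
  left_inv := by decide
  right_inv := by decide

lemma ext_compl_adj {V : Type} (G : SimpleGraph V) (x y : V ⊕ Fin 4) :
    (ext G)ᶜ.Adj (Sum.map id tau x) (Sum.map id tau y) ↔ (ext Gᶜ).Adj x y := by
  rcases x with u | i <;> rcases y with v | j
  · simp [ext, extAdj]
  · fin_cases j <;> simp [ext, extAdj, tau]
  · fin_cases i <;> simp [ext, extAdj, tau]
  · fin_cases i <;> fin_cases j <;> simp [ext, extAdj, tau, padj]

/-- complementation commutes with extension -/
def extComplIso {V : Type} (G : SimpleGraph V) : ext Gᶜ ≃g (ext G)ᶜ where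
  toEquiv := Equiv.sumCongr (Equiv.refl V) tau
  map_rel_iff' := by
    intro a b
    exact ext_compl_adj G a b

lemma cnt_sum {V C : Type} [Fintype V] (f : V → C) (g : Fin 4 → C) :
    cnt (Sum.elim f g) = cnt f + cnt g := by
  funext i
  simp only [cnt, Pi.add_apply, Fintype.sum_sum_type, Sum.elim_inl,
    Sum.elim_inr]

lemma pm_ext {V C : Type} [Fintype V] (G : SimpleGraph V) (f : V → C) (g : Fin 4 → C) :
    pm (ext G) (Sum.elim f g) =
      pm G f + (2 * (cnt f (g 1) + cnt f (g 2)) +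
        ∑ i, ∑ j, ind (padj i j ∧ g i = g j)) := by
  have e1 : ∀ c : C, (∑ u, ind (f u = c)) = cnt f c := fun c => rfl
  have e2 : ∀ c : C, (∑ u, ind (c = f u)) = cnt f c := by
    intro c; rw [← e1]; simp only [eq_comm]
  simp only [pm, Fintype.sum_sum_type, Sum.elim_inl, Sum.elim_inr, Finset.sum_add_distrib]
  have h1 : (∑ u : V, ∑ j : Fin 4, ind ((ext G).Adj (.inl u) (.inr j) ∧ f u = g j))
      = cnt f (g 1) + cnt f (g 2) := by
    rw [Finset.sum_comm]
    simp [Fin.sum_univ_four, ext, extAdj, e1, ind_ff]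
  have h2 : (∑ j : Fin 4, ∑ u : V, ind ((ext G).Adj (.inr j) (.inl u) ∧ g j = f u))
      = cnt f (g 1) + cnt f (g 2) := by
    simp [Fin.sum_univ_four, ext, extAdj, e2, ind_ff]
  rw [h1, h2]
  have h3 : (∑ u : V, ∑ v : V, ind ((ext G).Adj (.inl u) (.inl v) ∧ f u = f v))
    = ∑ u : V, ∑ v : V, ind (G.Adj u v ∧ f u = f v) := rfl
  have h4 : (∑ i : Fin 4, ∑ j : Fin 4, ind ((ext G).Adj (.inr i) (.inr j) ∧ g i = g j))
    = ∑ i : Fin 4, ∑ j : Fin 4, ind (padj i j ∧ g i = g j) := rfl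
  rw [h3, h4]
  ring

lemma sum_split {V C : Type} [Fintype V] [Fintype C] [DecidableEq V] (Φ : (V ⊕ Fin 4 → C) → ℤ) :
    ∑ h, Φ h = ∑ g : Fin 4 → C, ∑ f : V → C, Φ (Sum.elim f g) := by
  rw [← Equiv.sum_comp (Equiv.sumArrowEquivProdArrow V (Fin 4) C).symm, Fintype.sum_prod_type,
    Finset.sum_comm]
  rfl

lemma UEq.ext {V W : Type} [Fintype V] [Fintype W] [DecidableEq V] [DecidableEq W]
    {G : SimpleGraph V} {H : SimpleGraph W}
    (h : UEq G H) : UEq (ext G) (ext H) := by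
  intro k Ψ
  rw [sum_split, sum_split]
  refine Finset.sum_congr rfl fun g _ => ?_
  have := h k (fun x m => Ψ (x + cnt g) (m + (2 * (x (g 1) + x (g 2)) +
        ∑ i, ∑ j, ind (padj i j ∧ g i = g j))))
  simpa only [cnt_sum, pm_ext] using this

/-- vertices with exactly one neighbour or exactly one non-neighbour -/
def special {V : Type} (G : SimpleGraph V) (x : V) : Prop :=
  (∃! y, G.Adj x y) ∨ (∃! y, Gᶜ.Adj x y)

lemma leaf_iso {V W : Type} {G : SimpleGraph V} {H : SimpleGraph W} (e : G ≃g H) (x : V) :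
    (∃! y, H.Adj (e x) y) ↔ ∃! y, G.Adj x y := by
  constructor
  · rintro ⟨y, hy, hu⟩
    refine ⟨e.symm y, ?_, ?_⟩
    · change G.Adj x (e.symm y)
      rw [← e.map_adj_iff]; simpa using hy
    · intro z hz
      have := hu (e z) (e.map_adj_iff.2 hz)
      rw [← this]; simp
  · rintro ⟨y, hy, hu⟩
    refine ⟨e y, e.map_adj_iff.2 hy, ?_⟩
    intro z hz
    have : G.Adj x (e.symm z) := by rw [← e.map_adj_iff]; simpa using hz
    rw [← hu _ this]; simp

/-- an isomorphism also is an isomorphism of the complements -/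
def isoCompl {V W : Type} {G : SimpleGraph V} {H : SimpleGraph W} (e : G ≃g H) : Gᶜ ≃g Hᶜ where
  toEquiv := e.toEquiv
  map_rel_iff' := by
    intro a b
    have : H.Adj (e.toEquiv a) (e.toEquiv b) ↔ G.Adj a b := e.map_rel_iff
    rw [SimpleGraph.compl_adj, SimpleGraph.compl_adj, this, Ne, e.toEquiv.injective.eq_iff]

lemma special_iso {V W : Type} {G : SimpleGraph V} {H : SimpleGraph W} (e : G ≃g H) (x : V) :
    special H (e x) ↔ special G x := by
  unfold special
  rw [leaf_iso e x, ← leaf_iso (isoCompl e) x]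
  rfl

lemma special_compl {V : Type} (G : SimpleGraph V) (x : V) : special Gᶜ x ↔ special G x := by
  unfold special
  rw [compl_compl, or_comm]

lemma special_inl {V : Type} (G : SimpleGraph V) (v : V) : ¬ special (ext G) (.inl v) := by
  rintro (⟨y, hy, hu⟩ | ⟨y, hy, hu⟩)
  · have h1 := hu (.inr 1) (by simp [ext, extAdj])
    have h2 := hu (.inr 2) (by simp [ext, extAdj])
    rw [← h2] at h1; simp at h1
  · have h1 := hu (.inr 0) (by simp [ext, extAdj])
    have h2 := hu (.inr 3) (by simp [ext, extAdj])
    rw [← h2] at h1; simp at h1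

lemma special_inr {V : Type} (G : SimpleGraph V) (i : Fin 4) : special (ext G) (.inr i) := by
  fin_cases i
  · left
    refine ⟨.inr 1, by simp [ext, extAdj, padj], ?_⟩
    rintro (v | j) h
    · simp [ext, extAdj] at h
    · fin_cases j <;> simp [ext, extAdj, padj] at h ⊢
  · right
    refine ⟨.inr 3, by simp [ext, extAdj, padj], ?_⟩
    rintro (v | j) h
    · simp [ext, extAdj] at h
    · fin_cases j <;> simp [ext, extAdj, padj] at h ⊢
  · right
    refine ⟨.inr 0, by simp [ext, extAdj, padj], ?_⟩
    rintro (v | j) h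
    · simp [ext, extAdj] at h
    · fin_cases j <;> simp [ext, extAdj, padj] at h ⊢
  · left
    refine ⟨.inr 2, by simp [ext, extAdj, padj], ?_⟩
    rintro (v | j) h
    · simp [ext, extAdj] at h
    · fin_cases j <;> simp [ext, extAdj, padj] at h ⊢

lemma iso_of_ext {V : Type} [Finite V] (G : SimpleGraph V) (e : ext G ≃g (ext G)ᶜ) :
    Nonempty (G ≃g Gᶜ) := by
  have h : ∀ v : V, ∃ w : V, e (.inl v) = .inl w := by
    intro v
    rcases hx : e (.inl v) with w | i
    · exact ⟨w, rfl⟩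
    · exfalso
      apply special_inl G v
      rw [← special_iso e, special_compl, hx]
      exact special_inr G i
  choose φ hφ using h
  have inj : Function.Injective φ := by
    intro a b hab
    have : e (.inl a) = e (.inl b) := by rw [hφ, hφ, hab]
    simpa using e.injective this
  refine ⟨⟨Equiv.ofBijective φ (Finite.injective_iff_bijective.1 inj), ?_⟩⟩
  intro a b
  have h1 : (ext G)ᶜ.Adj (e (.inl a)) (e (.inl b)) ↔ (ext G).Adj (.inl a) (.inl b) :=
    e.map_adj_iff
  rw [hφ, hφ] at h1
  simpa [ext, extAdj] using h1

/-! ### The base graph -/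

/-- the adjacency table of the base graph -/
def adj8 (i j : Fin 8) : Bool :=
  (![![0, 0, 0, 1, 0, 1, 1, 1], ![0, 0, 0, 0, 1, 1, 0, 1], ![0, 0, 0, 0, 0, 1, 1, 1],
    ![1, 0, 0, 0, 0, 0, 1, 0], ![0, 1, 0, 0, 0, 0, 1, 0], ![1, 1, 1, 0, 0, 0, 0, 1],
    ![1, 0, 1, 1, 1, 0, 0, 1], ![1, 1, 1, 0, 0, 1, 1, 0]] i j : ℕ) == 1

/-- the base graph -/
def G0 : SimpleGraph (Fin 8) where
  Adj i j := adj8 i j = true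
  symm := ⟨by decide⟩
  loopless := ⟨by decide⟩

/-- degree in the base graph, computably -/
def deg8 (b : Bool) (i : Fin 8) : ℕ :=
  (Finset.univ.filter fun j : Fin 8 => (i ≠ j ∧ adj8 i j = b)).card

lemma G0_adj (i j : Fin 8) : G0.Adj i j ↔ (i ≠ j ∧ adj8 i j = true) := by
  constructor
  · intro h; exact ⟨h.ne, h⟩
  · intro h; exact h.2

lemma G0c_adj (i j : Fin 8) : G0ᶜ.Adj i j ↔ (i ≠ j ∧ adj8 i j = false) := by
  rw [SimpleGraph.compl_adj]
  change _ ∧ ¬ (adj8 i j = true) ↔ _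
  simp

lemma G0_not_iso : ¬ Nonempty (G0 ≃g G0ᶜ) := by
  rintro ⟨e⟩
  have hd : ∀ x, deg8 false (e x) = deg8 true x := by
    intro x
    unfold deg8
    symm
    refine Finset.card_bij (fun v _ => e v) ?_ ?_ ?_
    · intro a ha
      simp only [Finset.mem_filter, Finset.mem_univ, true_and] at ha ⊢
      rw [← G0c_adj, e.map_adj_iff, G0_adj]; exact ha
    · intro a _ b _ h; exact e.injective h
    · intro b hb
      refine ⟨e.symm b, ?_, by simp⟩
      simp only [Finset.mem_filter, Finset.mem_univ, true_and] at hb ⊢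
      rw [← G0_adj, ← e.map_adj_iff, G0c_adj]; simpa using hb
  have h1 : ∀ x, deg8 true x = 2 → ∃ y, (x ≠ y ∧ adj8 x y = true) ∧ deg8 true y = 5 := by decide
  have h2 : deg8 false 6 = 2 ∧ ¬ ∃ y, (6 ≠ y ∧ adj8 6 y = false) ∧ deg8 false y = 5 := by decide
  obtain ⟨y, hy, hy5⟩ := h1 (e.symm 6) (by rw [← hd]; simpa using h2.1)
  refine h2.2 ⟨e y, ?_, by rw [hd, hy5]⟩
  rw [← G0_adj, ← e.map_adj_iff, G0c_adj] at hy
  simpa using hy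

/-- indicator of a monochromatic pair -/
noncomputable def dl {C : Type} (f : Fin 8 → C) (i j : Fin 8) : ℕ := ind (f i = f j)

lemma dl_comm {C : Type} (f : Fin 8 → C) (i j : Fin 8) : dl f i j = dl f j i := by
  simp only [dl, eq_comm]

/-- common part of the base graph and its complement, after relabelling -/
noncomputable def mK {C : Type} (f : Fin 8 → C) : ℕ :=
  dl f 0 1 + dl f 0 2 + dl f 1 2 + dl f 1 3 + dl f 1 6 + dl f 2 3 + dl f 2 4 + dl f 3 4 + dl f 3 5 + dl f 3 7 + dl f 4 5 + dl f 4 7 + dl f 5 6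

/-- common part after the first contraction -/
noncomputable def mL {C : Type} (f : Fin 8 → C) : ℕ :=
  dl f 0 7 + dl f 3 7 + dl f 0 3 + dl f 0 2 + dl f 0 2 + dl f 0 5 + dl f 2 3 + dl f 1 3 + dl f 1 2 + dl f 1 6 + dl f 0 1 + dl f 5 6

/-- first relabelling -/
def t1 : Equiv.Perm (Fin 8) where
  toFun := ![2, 5, 7, 0, 6, 4, 1, 3]
  invFun := ![3, 6, 0, 7, 5, 1, 4, 2]
  left_inv := by decide
  right_inv := by decide

/-- second relabelling -/
def t2 : Equiv.Perm (Fin 8) where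
  toFun := ![7, 0, 3, 2, 1, 6, 5, 4]
  invFun := ![1, 4, 3, 2, 7, 6, 5, 0]
  left_inv := by decide
  right_inv := by decide

/-- third relabelling -/
def t3 : Equiv.Perm (Fin 8) where
  toFun := ![3, 2, 0, 1, 5, 7, 4, 6]
  invFun := ![2, 3, 1, 0, 6, 4, 7, 5]
  left_inv := by decide
  right_inv := by decide

lemma pm_eq {C : Type} (a : Fin 8 → Fin 8 → Bool) (G : SimpleGraph (Fin 8))
    (h : ∀ i j, G.Adj i j ↔ a i j = true) (f : Fin 8 → C) :
    pm G f = ∑ i, ∑ j, if a i j = true then dl f i j else 0 := by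
  unfold pm dl
  refine Finset.sum_congr rfl fun i _ => Finset.sum_congr rfl fun j _ => ?_
  rw [h]
  by_cases ha : a i j = true <;> simp [ha, ind_ff]

lemma pm_G0 {C : Type} (f : Fin 8 → C) :
    pm G0 f = 2 * (dl f 0 3 + dl f 0 5 + dl f 0 6 + dl f 0 7 + dl f 1 4 + dl f 1 5 + dl f 1 7 + dl f 2 5 + dl f 2 6 + dl f 2 7 + dl f 3 6 + dl f 4 6 + dl f 5 7 + dl f 6 7) := by
  rw [pm_eq adj8 G0 (fun i j => Iff.rfl)]
  simp [Fin.sum_univ_eight, adj8]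
  rw [dl_comm f 3 0, dl_comm f 5 0, dl_comm f 6 0, dl_comm f 7 0, dl_comm f 4 1, dl_comm f 5 1, dl_comm f 7 1, dl_comm f 5 2, dl_comm f 6 2, dl_comm f 7 2, dl_comm f 6 3, dl_comm f 6 4, dl_comm f 7 5, dl_comm f 7 6]
  ring

lemma pm_G0c {C : Type} (f : Fin 8 → C) :
    pm G0ᶜ f = 2 * (mK f + dl f 0 4) := by
  rw [pm_eq (fun i j => decide (i ≠ j ∧ adj8 i j = false)) G0ᶜ
    (fun i j => by rw [G0c_adj, decide_eq_true_iff])]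
  simp [Fin.sum_univ_eight, adj8, mK]
  rw [dl_comm f 1 0, dl_comm f 2 0, dl_comm f 4 0, dl_comm f 2 1, dl_comm f 3 1, dl_comm f 6 1, dl_comm f 3 2, dl_comm f 4 2, dl_comm f 4 3, dl_comm f 5 3, dl_comm f 7 3, dl_comm f 5 4, dl_comm f 7 4, dl_comm f 6 5]
  ring

lemma exchange {k : ℕ} (P d d' : (Fin 8 → Fin k) → ℕ) (K : (Fin 8 → Fin k) → ℕ)
    (hd : ∀ f, d f = 0 ∨ d f = 1) (hd' : ∀ f, d' f = 0 ∨ d' f = 1)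
    (h : ∀ Ψ : (Fin k → ℕ) → ℕ → ℤ,
      ∑ f, (P f * d f : ℤ) * Ψ (cnt f) (K f) = ∑ f, (P f * d' f : ℤ) * Ψ (cnt f) (K f))
    (Ψ : (Fin k → ℕ) → ℕ → ℤ) :
    ∑ f, (P f : ℤ) * Ψ (cnt f) (K f + d f) = ∑ f, (P f : ℤ) * Ψ (cnt f) (K f + d' f) := by
  have key : ∀ D : (Fin 8 → Fin k) → ℕ, (∀ f, D f = 0 ∨ D f = 1) →
      ∑ f, (P f : ℤ) * Ψ (cnt f) (K f + D f) =
        ∑ f, (P f : ℤ) * Ψ (cnt f) (K f) +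
          ∑ f, (P f * D f : ℤ) * (Ψ (cnt f) (K f + 1) - Ψ (cnt f) (K f)) := by
    intro D hD
    rw [← Finset.sum_add_distrib]
    refine Finset.sum_congr rfl fun f _ => ?_
    rcases hD f with h | h <;> rw [h] <;> push_cast <;> ring_nf
  rw [key d hd, key d' hd', h (fun x m => Ψ x (m + 1) - Ψ x m)]

lemma dl_01 {C : Type} (f : Fin 8 → C) (i j : Fin 8) : dl f i j = 0 ∨ dl f i j = 1 := by
  unfold dl ind; split_ifs <;> simp

lemma dl_congr {C : Type} {f : Fin 8 → C} {i j : Fin 8} (h : f i = f j) (l : Fin 8) :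
    dl f j l = dl f i l ∧ dl f l j = dl f l i := by
  simp [dl, h, ind_ff]

lemma step3 {k : ℕ} (Ψ : (Fin k → ℕ) → ℕ → ℤ) :
    ∑ f : Fin 8 → Fin k, (dl f 0 4 * dl f 2 6 : ℤ) * Ψ (cnt f) (mL f) =
      ∑ f : Fin 8 → Fin k, (dl f 0 4 * dl f 3 5 : ℤ) * Ψ (cnt f) (mL f) := by
  rw [sum_reindex t3]
  refine Finset.sum_congr rfl fun f _ => ?_
  rw [cnt_comp]
  have e1 : dl (fun v => f (t3 v)) 0 4 = dl f 3 5 := rfl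
  have e2 : dl (fun v => f (t3 v)) 2 6 = dl f 0 4 := rfl
  rw [e1, e2]
  by_cases h : f 0 = f 4
  · by_cases h' : f 3 = f 5
    · have : mL (fun v => f (t3 v)) = mL f := by
        change dl f 3 6 + dl f 1 6 + dl f 3 1 + dl f 3 0 + dl f 3 0 + dl f 3 7 + dl f 0 1 + dl f 2 1 + dl f 2 0 + dl f 2 4 + dl f 3 2 + dl f 7 4 = mL f
        have : dl f 3 1 = dl f 1 3 := dl_comm f _ _
        have : dl f 3 0 = dl f 0 3 := dl_comm f _ _
        have : dl f 2 1 = dl f 1 2 := dl_comm f _ _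
        have : dl f 2 0 = dl f 0 2 := dl_comm f _ _
        have : dl f 2 4 = dl f 0 2 := (dl_comm f _ _).trans (by simp only [dl, h, h'])
        have : dl f 3 2 = dl f 2 3 := dl_comm f _ _
        have : dl f 7 4 = dl f 0 7 := (dl_comm f _ _).trans (by simp only [dl, h, h'])
        have : dl f 0 5 = dl f 0 3 := by simp only [dl, h, h']
        have : dl f 5 6 = dl f 3 6 := by simp only [dl, h, h']
        unfold mL
        omega
      rw [this]; ring
    · simp [dl, h', ind_ff]
  · simp [dl, h, ind_ff]

lemma step2 {k : ℕ} (Ψ : (Fin k → ℕ) → ℕ → ℤ) :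
    ∑ f : Fin 8 → Fin k, (dl f 1 7 : ℤ) * Ψ (cnt f) (mK f) =
      ∑ f : Fin 8 → Fin k, (dl f 0 4 : ℤ) * Ψ (cnt f) (mK f) := by
  rw [sum_reindex t2]
  have := exchange (k := k) (fun f => dl f 0 4) (fun f => dl f 2 6) (fun f => dl f 3 5) mL
    (fun f => dl_01 f _ _) (fun f => dl_01 f _ _) (fun Ψ => step3 Ψ) Ψ
  refine Eq.trans ?_ (this.trans ?_)
  · refine Finset.sum_congr rfl fun f _ => ?_
    rw [cnt_comp]
    have e1 : dl (fun v => f (t2 v)) 1 7 = dl f 0 4 := rfl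
    rw [e1]
    by_cases h : f 0 = f 4
    · have : mK (fun v => f (t2 v)) = mL f + dl f 2 6 := by
        change dl f 7 0 + dl f 7 3 + dl f 0 3 + dl f 0 2 + dl f 0 5 + dl f 3 2 + dl f 3 1 + dl f 2 1 + dl f 2 6 + dl f 2 4 + dl f 1 6 + dl f 1 4 + dl f 6 5 = _
        have : dl f 7 0 = dl f 0 7 := dl_comm f _ _
        have : dl f 7 3 = dl f 3 7 := dl_comm f _ _
        have : dl f 3 2 = dl f 2 3 := dl_comm f _ _
        have : dl f 3 1 = dl f 1 3 := dl_comm f _ _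
        have : dl f 2 1 = dl f 1 2 := dl_comm f _ _
        have : dl f 2 4 = dl f 0 2 := (dl_comm f _ _).trans (by simp only [dl, h])
        have : dl f 1 4 = dl f 0 1 := (dl_comm f _ _).trans (by simp only [dl, h])
        have : dl f 6 5 = dl f 5 6 := dl_comm f _ _
        unfold mL
        omega
      rw [this]
    · simp [dl, h, ind_ff]
  · refine Finset.sum_congr rfl fun f _ => ?_
    by_cases h : f 0 = f 4
    · have : mK f = mL f + dl f 3 5 := by
        have : dl f 2 4 = dl f 0 2 := (dl_comm f _ _).trans (by simp only [dl, h])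
        have : dl f 3 4 = dl f 0 3 := (dl_comm f _ _).trans (by simp only [dl, h])
        have : dl f 4 5 = dl f 0 5 := by simp only [dl, h]
        have : dl f 4 7 = dl f 0 7 := by simp only [dl, h]
        unfold mL mK
        omega
      rw [this]
    · simp [dl, h, ind_ff]

lemma G0_UEq : UEq G0 G0ᶜ := by
  intro k Ψ
  rw [sum_reindex t1]
  have := exchange (k := k) (fun f => 1) (fun f => dl f 1 7) (fun f => dl f 0 4) mK
    (fun f => dl_01 f _ _) (fun f => dl_01 f _ _) (fun Ψ => by simpa using step2 Ψ)
    (fun x m => Ψ x (2 * m))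
  simp only [Nat.cast_one, one_mul] at this
  refine Eq.trans ?_ (this.trans ?_)
  · refine Finset.sum_congr rfl fun f _ => ?_
    rw [cnt_comp, pm_G0]
    congr 2
    change (dl f 2 0 + dl f 2 4 + dl f 2 1 + dl f 2 3 + dl f 5 6 + dl f 5 4 + dl f 5 3 + dl f 7 4 + dl f 7 1 + dl f 7 3 + dl f 0 1 + dl f 6 1 + dl f 4 3 + dl f 1 3) = _
    have : dl f 2 0 = dl f 0 2 := dl_comm f _ _
    have : dl f 2 1 = dl f 1 2 := dl_comm f _ _
    have : dl f 5 4 = dl f 4 5 := dl_comm f _ _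
    have : dl f 5 3 = dl f 3 5 := dl_comm f _ _
    have : dl f 7 4 = dl f 4 7 := dl_comm f _ _
    have : dl f 7 1 = dl f 1 7 := dl_comm f _ _
    have : dl f 7 3 = dl f 3 7 := dl_comm f _ _
    have : dl f 6 1 = dl f 1 6 := dl_comm f _ _
    have : dl f 4 3 = dl f 3 4 := dl_comm f _ _
    unfold mK
    omega
  · refine Finset.sum_congr rfl fun f _ => ?_
    rw [pm_G0c]


/-! ### From colourings to the subgraph sequence -/

/-- number of ways to distribute weighted objects so that the loads are `c` -/
noncomputable def dist {κ : Type} [Fintype κ] [DecidableEq κ] (w : κ → ℕ) {k : ℕ}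
    (c : Fin k → ℕ) : ℕ :=
  ∑ g : κ → Fin k, ind (∀ i, ∑ x, ind (g x = i) * w x = c i)

lemma exists_equiv {κ μ : Type} [Fintype κ] [Fintype μ] (w : κ → ℕ) (w' : μ → ℕ)
    (h : (Finset.univ.val.map w) = Finset.univ.val.map w') :
    ∃ e : κ ≃ μ, ∀ x, w x = w' (e x) := by
  have hc : ∀ y, Nonempty ({x // w x = y} ≃ {x // w' x = y}) := by
    intro y
    refine ⟨Fintype.equivOfCardEq ?_⟩
    have := congrArg (Multiset.count y) h
    rw [Multiset.count_map, Multiset.count_map] at this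
    rw [Fintype.card_subtype, Fintype.card_subtype]
    simp only [Finset.card_def, Finset.filter_val]
    simpa only [eq_comm] using this
  let e : κ ≃ μ := (Equiv.sigmaFiberEquiv w).symm.trans
    ((Equiv.sigmaCongrRight fun y => (hc y).some).trans (Equiv.sigmaFiberEquiv w'))
  refine ⟨e, fun x => ?_⟩
  exact (((hc (w x)).some ⟨x, rfl⟩).2).symm

lemma dist_congr {κ μ : Type} [Fintype κ] [Fintype μ] [DecidableEq κ] [DecidableEq μ]
    (w : κ → ℕ) (w' : μ → ℕ)
    (h : (Finset.univ.val.map w) = Finset.univ.val.map w') {k : ℕ} (c : Fin k → ℕ) :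
    dist w c = dist w' c := by
  obtain ⟨e, he⟩ := exists_equiv w w' h
  unfold dist
  rw [← Equiv.sum_comp (e.symm.arrowCongr (Equiv.refl (Fin k)))]
  refine Finset.sum_congr rfl fun g _ => ?_
  congr 1
  refine propext (forall_congr' fun i => ?_)
  rw [← Equiv.sum_comp e (fun x => ind (g x = i) * w' x)]
  simp only [he]
  rfl

lemma dist_ne_zero {κ : Type} [Fintype κ] [DecidableEq κ] (w : κ → ℕ) {k : ℕ}
    (c : Fin k → ℕ) (hc : ∀ i, c i ≠ 0) (h : dist w c ≠ 0) (hk : Fintype.card κ ≤ k) :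
    Finset.univ.val.map w = Finset.univ.val.map c := by
  obtain ⟨g, -, hg⟩ := Finset.exists_ne_zero_of_sum_ne_zero h
  have hg' : ∀ i, ∑ x, ind (g x = i) * w x = c i := by
    by_contra hn; exact hg (ind_false hn)
  have hs : Function.Surjective g := by
    intro i
    have := hc i
    rw [← hg' i] at this
    obtain ⟨x, -, hx⟩ := Finset.exists_ne_zero_of_sum_ne_zero this
    refine ⟨x, ?_⟩
    by_contra hn; exact hx (by rw [ind_false hn, zero_mul])
  have hb : Function.Bijective g := by
    rw [Fintype.bijective_iff_surjective_and_card]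
    refine ⟨hs, le_antisymm (by simpa using hk) ?_⟩
    exact Fintype.card_le_of_surjective g hs
  have hw : ∀ x, w x = c (g x) := by
    intro x
    rw [← hg' (g x), Finset.sum_eq_single x]
    · rw [ind_true rfl, one_mul]
    · intro y _ hy; rw [ind_false (fun h => hy (hb.1 h)), zero_mul]
    · simp
  have h2 : w = c ∘ g := funext hw
  rw [h2, ← Multiset.map_map]
  congr 1
  exact congrArg Finset.val (Finset.map_univ_equiv (Equiv.ofBijective g hb))

lemma dist_self {k : ℕ} (c : Fin k → ℕ) : dist c c ≠ 0 := by
  intro h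
  unfold dist at h
  rw [Finset.sum_eq_zero_iff] at h
  have := h id (Finset.mem_univ _)
  rw [ind_true] at this
  · simp at this
  · intro i
    simp only [id]
    rw [Finset.sum_eq_single i]
    · rw [ind_true rfl, one_mul]
    · intro y _ hy; rw [ind_false hy, zero_mul]
    · simp

/-- enumeration of a multiset -/
noncomputable def enum (ν : Multiset ℕ) (i : Fin ν.toList.length) : ℕ := ν.toList.get i

lemma enum_map (ν : Multiset ℕ) : Finset.univ.val.map (enum ν) = ν := by
  have : (Finset.univ : Finset (Fin ν.toList.length)).val =
    ((List.finRange ν.toList.length : List (Fin ν.toList.length)) : Multiset _) := rfl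
  rw [this, Multiset.map_coe]
  unfold enum
  rw [List.map_get_finRange, Multiset.coe_toList]

/-- `dist` as a function of the multiset of weights -/
noncomputable def mdist (ν : Multiset ℕ) {k : ℕ} (c : Fin k → ℕ) : ℕ := dist (enum ν) c

lemma triangular (A B : Multiset (Multiset ℕ)) (hA : ∀ ν ∈ A, 0 ∉ ν) (hB : ∀ ν ∈ B, 0 ∉ ν)
    (h : ∀ (k : ℕ) (c : Fin k → ℕ), (A.map fun ν => mdist ν c).sum = (B.map fun ν => mdist ν c).sum) :
    A = B := by
  -- one direction of the contradiction
  have key : ∀ A B : Multiset (Multiset ℕ), (∀ ν ∈ A, 0 ∉ ν) →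
      (∀ (k : ℕ) (c : Fin k → ℕ),
        (A.map fun ν => mdist ν c).sum = (B.map fun ν => mdist ν c).sum) →
      ∀ ν ∈ A, ν ∉ B → (∀ μ ∈ B, μ.card ≤ ν.card) → False := by
    intro A B hA h ν hν hνB hmax
    have h1 := h _ (enum ν)
    have h2 : (B.map fun μ => mdist μ (enum ν)).sum = 0 := by
      rw [Multiset.sum_eq_zero_iff]
      intro x hx
      obtain ⟨μ, hμ, rfl⟩ := Multiset.mem_map.1 hx
      by_contra hne
      have := dist_ne_zero (enum μ) (enum ν) ?_ hne ?_
      · rw [enum_map, enum_map] at this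
        exact hνB (this ▸ hμ)
      · intro i hi
        apply hA ν hν
        rw [← hi, ← Multiset.mem_toList]
        exact List.get_mem _ _
      · simpa using hmax μ hμ
    rw [h2, Multiset.sum_eq_zero_iff] at h1
    exact dist_self (enum ν) (h1 _ (Multiset.mem_map_of_mem _ hν))
  -- cancel the common part
  set A' := A - A ∩ B with hA'
  set B' := B - A ∩ B with hB'
  have eA : A = A' + A ∩ B := (tsub_add_cancel_of_le Multiset.inter_le_left).symm
  have eB : B = B' + A ∩ B := (tsub_add_cancel_of_le Multiset.inter_le_right).symm
  have hd : ∀ ν, ν ∈ A' → ν ∉ B' := by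
    intro ν h1 h2
    rw [← Multiset.count_pos] at h1 h2
    rw [hA', Multiset.count_sub, Multiset.count_inter] at h1
    rw [hB', Multiset.count_sub, Multiset.count_inter] at h2
    omega
  have h' : ∀ (k : ℕ) (c : Fin k → ℕ),
      (A'.map fun ν => mdist ν c).sum = (B'.map fun ν => mdist ν c).sum := by
    intro k c
    have := h k c
    have sA := congrArg (fun S => (Multiset.map (fun ν => mdist ν c) S).sum) eA
    have sB := congrArg (fun S => (Multiset.map (fun ν => mdist ν c) S).sum) eB
    simp only [Multiset.map_add, Multiset.sum_add] at sA sB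
    omega
  have lA : A' ≤ A := tsub_le_self
  have lB : B' ≤ B := tsub_le_self
  suffices hz : A' + B' = 0 by
    have hz' := add_eq_zero.1 hz
    rw [hz'.1] at eA
    rw [hz'.2] at eB
    exact eA.trans eB.symm
  by_contra hne
  have hne' : (A' + B').toFinset.Nonempty := by
    rw [Finset.nonempty_iff_ne_empty, Ne, Multiset.toFinset_eq_empty]; exact hne
  obtain ⟨ν, hν, hmax⟩ := Finset.exists_max_image _ Multiset.card hne'
  have hmax' : ∀ μ ∈ A' + B', μ.card ≤ ν.card := fun μ hμ => hmax μ (by simpa using hμ)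
  rw [Multiset.mem_toFinset, Multiset.mem_add] at hν
  rcases hν with hν | hν
  · exact key A' B' (fun μ hμ => hA μ (Multiset.mem_of_le lA hμ)) h' ν hν (hd ν hν)
      (fun μ hμ => hmax' μ (Multiset.mem_add.2 (Or.inr hμ)))
  · exact key B' A' (fun μ hμ => hB μ (Multiset.mem_of_le lB hμ)) (fun k c => (h' k c).symm) ν hν
      (fun hh => hd ν hh hν)
      (fun μ hμ => hmax' μ (Multiset.mem_add.2 (Or.inl hμ)))

lemma componentOrders_eq {n : ℕ} (G : SimpleGraph (Fin n)) :
    componentOrders G = (Finset.univ : Finset G.ConnectedComponent).val.map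
      fun c => Nat.card c.supp := by
  unfold componentOrders
  congr 1
  refine (Multiset.Nodup.ext (Multiset.nodup_dedup _) Finset.univ.nodup).2 fun c => ?_
  simp only [Multiset.mem_dedup, Multiset.mem_map, Finset.mem_val, Finset.mem_univ, true_and,
    iff_true]
  exact c.exists_rep

lemma componentOrders_pos {n : ℕ} (G : SimpleGraph (Fin n)) : 0 ∉ componentOrders G := by
  rw [componentOrders_eq]
  intro h
  obtain ⟨c, -, hc⟩ := Multiset.mem_map.1 h
  have : Nonempty c.supp := by
    obtain ⟨v, hv⟩ := c.exists_rep
    exact ⟨⟨v, hv⟩⟩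
  exact (Nat.card_pos (α := c.supp)).ne' hc

lemma sum_ind {α : Type} [Fintype α] (p : α → Prop) :
    ∑ a, ind (p a) = (Finset.univ.filter p).card := by
  unfold ind
  rw [Finset.card_filter]

lemma sum_ind_finset {α : Type} (s : Finset α) (p : α → Prop) :
    ∑ a ∈ s, ind (p a) = (s.filter p).card := by
  unfold ind
  rw [Finset.card_filter]

lemma cnt_lift {n k : ℕ} (G : SimpleGraph (Fin n)) (g : G.ConnectedComponent → Fin k) (i : Fin k) :
    cnt (fun v => g (G.connectedComponentMk v)) i =
      ∑ x, ind (g x = i) * Nat.card x.supp := by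
  have h : ∀ x : G.ConnectedComponent, Nat.card x.supp =
      ∑ v, ind (G.connectedComponentMk v = x) := by
    intro x
    rw [sum_ind, Nat.card_eq_fintype_card, Fintype.card_subtype]
    congr 1
    ext v
    simp
  simp only [h, Finset.mul_sum]
  rw [Finset.sum_comm]
  refine Finset.sum_congr rfl fun v _ => ?_
  rw [Finset.sum_eq_single (G.connectedComponentMk v)]
  · rw [ind_true (p := G.connectedComponentMk v = _) rfl, mul_one]
  · intro y _ hy; rw [ind_false (p := G.connectedComponentMk v = y) (fun h => hy h.symm), mul_zero]
  · simp

/-- colourings constant on components -/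
lemma dist_components {n k : ℕ} (G : SimpleGraph (Fin n)) (c : Fin k → ℕ) :
    ∑ f : Fin n → Fin k, ind (cnt f = c ∧ ∀ u v, G.Adj u v → f u = f v) =
      mdist (componentOrders G) c := by
  unfold mdist
  rw [dist_congr (enum (componentOrders G)) (fun x : G.ConnectedComponent => Nat.card x.supp)
    (by rw [enum_map, componentOrders_eq])]
  unfold dist
  rw [sum_ind, sum_ind]
  symm
  refine Finset.card_bij (fun g _ => fun v => g (G.connectedComponentMk v)) ?_ ?_ ?_
  · intro g hg
    simp only [Finset.mem_filter, Finset.mem_univ, true_and] at hg ⊢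
    refine ⟨funext fun i => ?_, fun u v huv => ?_⟩
    · rw [cnt_lift, hg i]
    · rw [SimpleGraph.ConnectedComponent.sound huv.reachable]
  · intro g _ g' _ h
    funext x
    obtain ⟨v, rfl⟩ := x.exists_rep
    exact congrFun h v
  · intro f hf
    simp only [Finset.mem_filter, Finset.mem_univ, true_and] at hf
    have hr : ∀ u v, G.Reachable u v → f u = f v := by
      rintro u v ⟨p⟩
      induction p with
      | nil => rfl
      | cons h _ ih => exact (hf.2 _ _ h).trans ih
    obtain ⟨g, hg⟩ : ∃ g : G.ConnectedComponent → Fin k,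
        (fun v => g (G.connectedComponentMk v)) = f := ⟨Quot.lift f hr, rfl⟩
    refine ⟨g, ?_, hg⟩
    simp only [Finset.mem_filter, Finset.mem_univ, true_and]
    intro i
    rw [← cnt_lift, ← hf.1, hg]

/-- the monochromatic subgraph -/
def mono {n k : ℕ} (G : SimpleGraph (Fin n)) (f : Fin n → Fin k) : SimpleGraph (Fin n) where
  Adj u v := G.Adj u v ∧ f u = f v
  symm := ⟨fun _ _ h => ⟨h.1.symm, h.2.symm⟩⟩
  loopless := ⟨fun _ h => h.1.ne rfl⟩

lemma pm_mono {n k : ℕ} (G : SimpleGraph (Fin n)) (f : Fin n → Fin k) :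
    pm G f = 2 * (mono G f).edgeFinset.card := by
  rw [← SimpleGraph.sum_degrees_eq_twice_card_edges]
  unfold pm
  refine Finset.sum_congr rfl fun u _ => ?_
  rw [sum_ind, ← SimpleGraph.card_neighborFinset_eq_degree]
  congr 1
  ext v
  rw [SimpleGraph.mem_neighborFinset]
  simp only [Finset.mem_filter, Finset.mem_univ, true_and]
  exact Iff.rfl

lemma subset_mono {n k : ℕ} (G : SimpleGraph (Fin n)) (f : Fin n → Fin k)
    (F : Finset (Sym2 (Fin n))) :
    F ⊆ (mono G f).edgeFinset ↔ F ⊆ G.edgeFinset ∧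
      ∀ u v, (SimpleGraph.fromEdgeSet (F : Set (Sym2 (Fin n)))).Adj u v → f u = f v := by
  constructor
  · intro h
    refine ⟨fun e he => ?_, fun u v huv => ?_⟩
    · have := h he
      induction e with
      | _ u v =>
        rw [SimpleGraph.mem_edgeFinset, SimpleGraph.mem_edgeSet] at this ⊢
        exact this.1
    · rw [SimpleGraph.fromEdgeSet_adj] at huv
      have := h (Finset.mem_coe.1 huv.1)
      rw [SimpleGraph.mem_edgeFinset, SimpleGraph.mem_edgeSet] at this
      exact this.2
  · rintro ⟨h1, h2⟩ e he
    have h3 := h1 he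
    induction e with
    | _ u v =>
      rw [SimpleGraph.mem_edgeFinset, SimpleGraph.mem_edgeSet] at h3 ⊢
      exact ⟨h3, h2 u v ((SimpleGraph.fromEdgeSet_adj _).2 ⟨Finset.mem_coe.2 he, h3.ne⟩)⟩

lemma choose_mono {n k : ℕ} (G : SimpleGraph (Fin n)) (f : Fin n → Fin k) (j : ℕ) :
    (pm G f / 2).choose j = ∑ F ∈ G.edgeFinset.powersetCard j,
      ind (∀ u v, (SimpleGraph.fromEdgeSet (F : Set (Sym2 (Fin n)))).Adj u v → f u = f v) := by
  rw [pm_mono, Nat.mul_div_cancel_left _ (by norm_num), ← Finset.card_powersetCard]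
  rw [sum_ind_finset]
  congr 1
  ext F
  simp only [Finset.mem_powersetCard, Finset.mem_filter, subset_mono]
  tauto

lemma main_count {n k : ℕ} (G : SimpleGraph (Fin n)) (c : Fin k → ℕ) (j : ℕ) :
    ∑ f : Fin n → Fin k, ind (cnt f = c) * (pm G f / 2).choose j =
      (((G.edgeFinset.powersetCard j).val.map fun F : Finset (Sym2 (Fin n)) =>
        componentOrders (SimpleGraph.fromEdgeSet (F : Set (Sym2 (Fin n))))).map
          fun ν => mdist ν c).sum := by
  simp only [choose_mono, Finset.mul_sum]
  rw [Finset.sum_comm, Multiset.map_map]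
  refine Finset.sum_congr rfl fun F _ => ?_
  simp only [Function.comp]
  rw [← dist_components]
  refine Finset.sum_congr rfl fun f _ => ?_
  by_cases h : cnt f = c
  · simp [h, ind_tt]
  · simp [h, ind_ff]

lemma subgraphSeq_eq {n m : ℕ} (G : SimpleGraph (Fin n)) (H : SimpleGraph (Fin m))
    (h : UEq G H) : subgraphSeq G = subgraphSeq H := by
  have hj : ∀ j, ((G.edgeFinset.powersetCard j).val.map fun F : Finset (Sym2 (Fin n)) =>
        componentOrders (SimpleGraph.fromEdgeSet (F : Set (Sym2 (Fin n))))) =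
      ((H.edgeFinset.powersetCard j).val.map fun F : Finset (Sym2 (Fin m)) =>
        componentOrders (SimpleGraph.fromEdgeSet (F : Set (Sym2 (Fin m))))) := by
    intro j
    apply triangular
    · intro ν hν
      obtain ⟨F, -, rfl⟩ := Multiset.mem_map.1 hν
      exact componentOrders_pos _
    · intro ν hν
      obtain ⟨F, -, rfl⟩ := Multiset.mem_map.1 hν
      exact componentOrders_pos _
    · intro k c
      rw [← main_count, ← main_count]
      have := h k (fun x p => ((ind (x = c) * (p / 2).choose j : ℕ) : ℤ))
      exact_mod_cast this
  have cnt_seq : ∀ (l : ℕ) (K : SimpleGraph (Fin l)) (j : ℕ) (ν : Multiset ℕ),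
      Multiset.count (j, ν) (subgraphSeq K) = Multiset.count ν
        ((K.edgeFinset.powersetCard j).val.map fun F : Finset (Sym2 (Fin l)) =>
        componentOrders (SimpleGraph.fromEdgeSet (F : Set (Sym2 (Fin l))))) := by
    intro l K j ν
    unfold subgraphSeq
    rw [Multiset.count_map, Multiset.count_map]
    rw [← Finset.filter_val, ← Finset.filter_val, ← Finset.card_def, ← Finset.card_def]
    congr 1
    ext F
    simp only [Finset.mem_powersetCard, Finset.mem_filter, Finset.mem_powerset, Prod.mk.injEq]
    tauto
  ext ⟨j, ν⟩
  rw [cnt_seq, cnt_seq, hj]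

lemma exists_graph (t : ℕ) : ∃ G : SimpleGraph (Fin (8 + 4 * t)),
    ¬ Nonempty (G ≃g Gᶜ) ∧ UEq G Gᶜ := by
  induction t with
  | zero => exact ⟨G0, G0_not_iso, G0_UEq⟩
  | succ t ih =>
    obtain ⟨G, h1, h2⟩ := ih
    let e : Fin (8 + 4 * (t + 1)) ≃ Fin (8 + 4 * t) ⊕ Fin 4 :=
      (finCongr (by ring)).trans finSumFinEquiv.symm
    let H : SimpleGraph (Fin (8 + 4 * (t + 1))) := (ext G).comap e
    let i : H ≃g ext G := SimpleGraph.Iso.comap e (ext G)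
    refine ⟨H, ?_, ?_⟩
    · rintro ⟨φ⟩
      exact h1 (iso_of_ext G (i.symm.trans (φ.trans (isoCompl i))))
    · exact (UEq.of_iso i).trans ((UEq.ext h2).trans
        ((UEq.of_iso (extComplIso G)).trans (UEq.of_iso (isoCompl i).symm)))

end SubSeq

/-- For every `N` there is a graph on more than `N` vertices that is not isomorphic to its
complement but has the same subgraph sequence as its complement. -/
theorem stmt_11 (N : ℕ) :
    ∃ (n : ℕ) (G : SimpleGraph (Fin n)),
      n > N ∧ ¬ Nonempty (G ≃g Gᶜ) ∧ subgraphSeq G = subgraphSeq Gᶜ := by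
  obtain ⟨G, h1, h2⟩ := SubSeq.exists_graph N
  exact ⟨8 + 4 * N, G, by omega, h1, SubSeq.subgraphSeq_eq G Gᶜ h2⟩
end
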